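/- Let k be a field and F a bad field generator of A = k[X,Y]. Then F is a very bad field generator of A (i.e., F is a bad field generator of every B with A ⊆ B, B = k[U,V], Frac(B) = Frac(A)) if and only if Γ_alg(F,A) = ∅, i.e., no prime ideal p of A satisfies that k[F] → A/p is an isomorphism. -/

import Mathlib

section

open MvPolynomial

/-- The set `Γ_alg(F,A)` of primes `p` of `A = k[X,Y]` such that the composite
`k[F] ↪ A → A/p` is an isomorphism. -/
def GammaAlg (k : Type) [Field k] (F : MvPolynomial (Fin 2) k) :
    Set (Ideal (MvPolynomial (Fin 2) k)) :=
  {p | p.IsPrime ∧ Function.Bijective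
    (fun q : Polynomial k => Ideal.Quotient.mk p (Polynomial.aeval F q))}

end

/-- Two elements of a valued field have the same leading term. -/
def SameLead {W Γ₀ : Type*} [Field W] [LinearOrderedCommGroupWithZero Γ₀]
    (v : Valuation W Γ₀) (a b : W) : Prop := v (a - b) < v b

namespace SameLead

variable {W Γ₀ : Type*} [Field W] [LinearOrderedCommGroupWithZero Γ₀] {v : Valuation W Γ₀}
  {a b c d : W}

theorem ne_zero_right (h : SameLead v a b) : b ≠ 0 := by
  rintro rfl
  simp [SameLead] at h

theorem val_eq (h : SameLead v a b) : v a = v b := v.map_eq_of_sub_lt h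

theorem ne_zero_left (h : SameLead v a b) : a ≠ 0 := by
  intro h0
  have := h.val_eq
  rw [h0, map_zero, eq_comm, map_eq_zero] at this
  exact h.ne_zero_right this

theorem refl (h : a ≠ 0) : SameLead v a a := by
  simpa [SameLead, zero_lt_iff] using h

theorem symm (h : SameLead v a b) : SameLead v b a := by
  unfold SameLead
  rw [h.val_eq, Valuation.map_sub_swap]
  exact h

theorem trans (h : SameLead v a b) (h' : SameLead v b c) : SameLead v a c := by
  unfold SameLead
  rw [← sub_add_sub_cancel a b c]
  exact v.map_add_lt (h'.val_eq ▸ h) h'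

theorem mul (h : SameLead v a b) (h' : SameLead v c d) : SameLead v (a * c) (b * d) := by
  unfold SameLead
  have : a * c - b * d = (a - b) * c + b * (c - d) := by ring
  rw [this]
  apply v.map_add_lt
  · rw [map_mul, map_mul, h'.val_eq]
    exact mul_lt_mul_of_pos_right h (zero_lt_iff.2 (by simpa using h'.ne_zero_right))
  · rw [map_mul, map_mul]
    exact mul_lt_mul_of_pos_left h' (zero_lt_iff.2 (by simpa using h.ne_zero_right))

theorem inv (h : SameLead v a b) : SameLead v a⁻¹ b⁻¹ := by
  have ha := h.ne_zero_left
  have hb := h.ne_zero_right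
  have : SameLead v (a⁻¹ * b⁻¹ * b) (a⁻¹ * b⁻¹ * a) :=
    (SameLead.refl (mul_ne_zero (inv_ne_zero ha) (inv_ne_zero hb))).mul h.symm
  convert this using 1 <;> field_simp

theorem div (h : SameLead v a b) (h' : SameLead v c d) : SameLead v (a / c) (b / d) := by
  rw [div_eq_mul_inv, div_eq_mul_inv]
  exact h.mul h'.inv

theorem pow (h : SameLead v a b) (n : ℕ) : SameLead v (a ^ n) (b ^ n) := by
  induction n with
  | zero => simpa using SameLead.refl one_ne_zero
  | succ n ih => simpa [pow_succ] using ih.mul h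

theorem zpow (h : SameLead v a b) (n : ℤ) : SameLead v (a ^ n) (b ^ n) := by
  cases n with
  | ofNat n => simpa using h.pow n
  | negSucc n => simpa [zpow_negSucc] using (h.pow (n + 1)).inv

theorem multiset_prod {ι : Type*} (s : Multiset ι) {f g : ι → W}
    (h : ∀ i ∈ s, SameLead v (f i) (g i)) : SameLead v (s.map f).prod (s.map g).prod := by
  induction s using Multiset.induction with
  | empty => simpa using SameLead.refl one_ne_zero
  | cons i s ih =>
    simp only [Multiset.map_cons, Multiset.prod_cons]
    exact (h i (by simp)).mul (ih fun j hj => h j (by simp [hj]))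

/-- The term of larger value dominates a sum. -/
theorem add_left (h : v b < v a) : SameLead v (a + b) a := by
  simpa [SameLead] using h

end SameLead

section Approx

open Polynomial

variable {K W Γ₀ : Type*} [Field K] [Field W] [Algebra K W] [IsAlgClosed W]
  [LinearOrderedCommGroupWithZero Γ₀] {v : Valuation W Γ₀} {τ α : W}

theorem aeval_eq_lead_prod (f : K[X]) (x : W) :
    aeval x f = algebraMap K W f.leadingCoeff * ((f.aroots W).map fun β => x - β).prod :=
  (IsAlgClosed.splits (f.map (algebraMap K W))).aeval_eq_prod_aroots x

theorem sameLead_aeval {f : K[X]} (hf : f ≠ 0)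
    (h : ∀ β ∈ f.aroots W, v (τ - α) < v (β - α)) : SameLead v (aeval τ f) (aeval α f) := by
  rw [aeval_eq_lead_prod f τ, aeval_eq_lead_prod f α]
  refine (SameLead.refl (by simpa using hf)).mul (SameLead.multiset_prod _ fun β hβ => ?_)
  unfold SameLead
  rw [Valuation.map_sub_swap v α β, sub_sub_sub_cancel_right]
  exact h β hβ

/-- `α` is a best approximation of `τ` among the elements algebraic over `K`. -/
def IsBestApprox (K : Type*) {W Γ₀ : Type*} [Field K] [Field W] [Algebra K W]
    [LinearOrderedCommGroupWithZero Γ₀] (v : Valuation W Γ₀) (τ α : W) : Prop :=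
  IsAlgebraic K α ∧ ∀ γ : W, IsAlgebraic K γ → v (τ - α) ≤ v (τ - γ)

theorem IsBestApprox.not_sameLead (hα : IsBestApprox K v τ α) {f : K[X]} {β : W}
    (hβ : aeval β f = 0) (hf : f ≠ 0) (hc : v (β - α) ≤ v (τ - α)) {μ : W}
    (hμ : IsAlgebraic K μ) : ¬ SameLead v (aeval τ f) μ := by
  intro h
  by_cases h0 : f.natDegree = 0
  · rw [Polynomial.eq_C_of_natDegree_eq_zero h0] at hβ hf
    simp at hβ hf
    exact hf hβ
  have hβa : IsAlgebraic K β := ⟨f, hf, hβ⟩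
  let g : Polynomial W := f.map (algebraMap K W) - C μ
  have hg (x : W) : aeval x f - μ = g.leadingCoeff * (g.roots.map fun γ => x - γ).prod := by
    rw [← (IsAlgClosed.splits g).eval_eq_prod_roots x]
    simp [g, Polynomial.aeval_def, Polynomial.eval_map]
  have hγ : ∀ γ ∈ g.roots, v (β - γ) ≤ v (τ - γ) := by
    intro γ hγ
    have hγ' : IsAlgebraic K γ := by
      refine IsAlgebraic.of_aeval f h0 (by simp [hf]) ?_
      have := Polynomial.isRoot_of_mem_roots hγ
      have e : aeval γ f = μ := by
        simpa [g, sub_eq_zero, Polynomial.aeval_def, Polynomial.eval_map] using this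
      rwa [e]
    have h1 := hα.2 γ hγ'
    have : β - γ = (β - α) - (τ - α) + (τ - γ) := by ring
    rw [this]
    refine v.map_add_le (v.map_sub_le (hc.trans h1) h1) le_rfl
  have h1 : v (aeval β f - μ) ≤ v (aeval τ f - μ) := by
    rw [hg, hg, map_mul, map_mul]
    refine mul_le_mul_right ?_ _
    rw [map_multiset_prod, map_multiset_prod, Multiset.map_map, Multiset.map_map]
    exact Multiset.prod_map_le_prod_map₀ _ _ (fun _ _ => zero_le) hγ
  rw [hβ, zero_sub, Valuation.map_neg] at h1
  exact absurd h (not_lt.2 h1)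

theorem exists_isBestApprox {p q : K[X]} (hp : aeval τ p ≠ 0) (hq : aeval τ q ≠ 0)
    (hu : ∀ μ : W, IsAlgebraic K μ → ¬ SameLead v (aeval τ p / aeval τ q) μ) :
    ∃ α, IsBestApprox K v τ α := by
  have hp0 : p ≠ 0 := by rintro rfl; simp at hp
  have hq0 : q ≠ 0 := by rintro rfl; simp at hq
  classical
  let S : Finset W := insert 0 ((p * q).aroots W).toFinset
  obtain ⟨α, hαS, hα⟩ := S.exists_min_image (fun β => v (τ - β)) ⟨0, by simp [S]⟩
  have hSalg : ∀ β ∈ S, IsAlgebraic K β := by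
    intro β hβ
    rcases Finset.mem_insert.1 hβ with rfl | hβ
    · exact isAlgebraic_zero
    · rw [Multiset.mem_toFinset, Polynomial.mem_aroots] at hβ
      exact ⟨_, hβ.1, hβ.2⟩
  refine ⟨α, hSalg α hαS, fun γ hγ => ?_⟩
  by_contra! hlt
  have key : ∀ f : K[X], f ≠ 0 → f ∣ p * q → SameLead v (aeval τ f) (aeval γ f) := by
    intro f hf hd
    refine sameLead_aeval hf fun β hβ => ?_
    have hβS : β ∈ S := by
      refine Finset.mem_insert_of_mem ?_
      rw [Multiset.mem_toFinset, Polynomial.mem_aroots]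
      rw [Polynomial.mem_aroots] at hβ
      exact ⟨mul_ne_zero hp0 hq0, by
        obtain ⟨g, hg⟩ := hd
        rw [hg, map_mul, hβ.2, zero_mul]⟩
    have h1 : v (τ - γ) < v (τ - β) := hlt.trans_le (hα β hβS)
    have : β - γ = (τ - γ) - (τ - β) := by ring
    rwa [this, v.map_sub_eq_of_lt_right h1]
  refine hu _ ?_ ((key p hp0 (dvd_mul_right _ _)).div (key q hq0 (dvd_mul_left _ _)))
  have hh (f : K[X]) : IsAlgebraic K (aeval γ f) :=
    isAlgebraic_iff_isIntegral.2 (.of_mem_of_fg _ hγ.isIntegral.fg_adjoin_singleton _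
      (aeval_mem_adjoin_singleton _ _))
  rw [div_eq_mul_inv]
  exact (hh p).mul (hh q).inv

end Approx

section Independence

open Polynomial IntermediateField IntermediateField.algebraAdjoinAdjoin

variable {k M Γ₀ : Type*} [Field k] [Field M] [Algebra k M]
  [LinearOrderedCommGroupWithZero Γ₀] {v : Valuation M Γ₀}

theorem transcendental_adjoin_iff_adjoin_simple {a b : M} :
    Transcendental (Algebra.adjoin k {a}) b ↔ Transcendental k⟮a⟯ b :=
  (IsFractionRing.isAlgebraic_iff (Algebra.adjoin k {a}) k⟮a⟯ M).not

theorem algebraicIndependent_pair_iff {a b : M} :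
    AlgebraicIndependent k ![a, b] ↔ Transcendental k a ∧ Transcendental k⟮a⟯ b := by
  rw [AlgebraicIndependent.iff_transcendental_adjoin_image (1 : Fin 2),
    ← transcendental_adjoin_iff_adjoin_simple]
  have h1 : ![a, b] '' {1}ᶜ = {a} := by
    ext x
    simp [Fin.exists_fin_two, eq_comm]
  rw [h1]
  have : Unique {j : Fin 2 // j ≠ 1} := ⟨⟨⟨0, by simp⟩⟩, by rintro ⟨j, hj⟩; ext; simp; omega⟩
  rw [algebraicIndependent_unique_type_iff]
  have : (default : {j : Fin 2 // j ≠ 1}).1 = 0 := by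
    have := (default : {j : Fin 2 // j ≠ 1}).2
    omega
  rw [this]
  rfl

theorem AlgebraicIndependent.pair_swap {a b : M} (h : AlgebraicIndependent k ![a, b]) :
    AlgebraicIndependent k ![b, a] := by
  have := h.comp ![1, 0] (by decide)
  convert this using 1
  ext i; fin_cases i <;> rfl

theorem Valuation.le_one_of_isIntegral {K : Type*} [CommRing K] [Algebra K M]
    (hK : ∀ c : K, v (algebraMap K M c) ≤ 1) {x : M} (hx : IsIntegral K x) : v x ≤ 1 := by
  let g : K →+* v.valuationSubring := (algebraMap K M).codRestrict _ hK
  have hx' : IsIntegral v.valuationSubring x := by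
    obtain ⟨p, hp, h0⟩ := hx
    exact ⟨p.map g, hp.map g, by rw [eval₂_map]; exact h0⟩
  exact (Valuation.integer.integers v).mem_of_integral hx'

/-- If `v` is trivial on `k[μ]` then it is trivial on `k(μ)`. -/
theorem Valuation.eq_one_of_mem_adjoin_simple {μ : M}
    (hμ : ∀ p : k[X], p ≠ 0 → v (aeval μ p) = 1) {x : M} (hx : x ∈ k⟮μ⟯) (hx0 : x ≠ 0) :
    v x = 1 := by
  obtain ⟨r, s, rfl⟩ := (mem_adjoin_simple_iff _ _).1 hx
  rw [map_div₀, hμ r (by rintro rfl; simp at hx0), hμ s (by rintro rfl; simp at hx0), div_one]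

theorem algebraicIndependent_of_valuation {μ ρ : M}
    (hμ : ∀ p : k[X], p ≠ 0 → v (aeval μ p) = 1) (hρ : 1 < v ρ) :
    AlgebraicIndependent k ![μ, ρ] := by
  rw [algebraicIndependent_pair_iff]
  constructor
  · rintro ⟨p, hp, h0⟩
    simpa [h0] using hμ p hp
  · intro h
    refine hρ.not_ge (Valuation.le_one_of_isIntegral (K := k⟮μ⟯) ?_ h.isIntegral)
    intro c
    by_cases hc : (c : M) = 0
    · simp [hc]
    · exact (Valuation.eq_one_of_mem_adjoin_simple hμ c.2 hc).le

/-- If `v` is trivial on `k`, then an element algebraic over `k(ρ)` with `ρ` of large value has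
algebraic residue. -/
theorem exists_aeval_lt_one {ρ μ : M} (hρ : 1 < v ρ) (hμ : v μ ≤ 1)
    (hk : ∀ c : k, v (algebraMap k M c) ≤ 1) (halg : IsAlgebraic k⟮ρ⟯ μ) :
    ∃ p : k[X], p ≠ 0 ∧ v (aeval μ p) < 1 := by
  by_contra! h
  refine (algebraicIndependent_pair_iff.1 (algebraicIndependent_of_valuation (v := v) (k := k)
    (μ := μ) (fun p hp => le_antisymm ?_ (h p hp)) hρ).pair_swap).2 halg
  have : aeval μ p ∈ v.integer := by
    rw [aeval_eq_sum_range]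
    refine sum_mem fun i _ => ?_
    rw [Algebra.smul_def]
    exact mul_mem (hk _) (pow_mem hμ i)
  exact this

end Independence

section Specialization

open Polynomial IntermediateField

variable {k W : Type*} [Field k] [Field W] [Algebra k W]

/-- An evaluation embedding `j : k(X) → W` together with an element `q` of value less than `1`, such
that `v` is trivial on the image of `j`. -/
structure IsSpecialization {Γ₀ : Type*} [LinearOrderedCommGroupWithZero Γ₀] (v : Valuation W Γ₀)
    (j : RatFunc k →ₐ[k] W) (q : W) : Prop where
  val_eq_one : ∀ φ : RatFunc k, φ ≠ 0 → v (j φ) = 1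
  ne_zero : q ≠ 0
  val_lt_one : v q < 1

theorem exists_ratFunc_algHom {p : W} (hp : Transcendental k p) :
    ∃ j : RatFunc k →ₐ[k] W, j RatFunc.X = p :=
  ⟨k⟮p⟯.val.comp (RatFunc.algEquivOfTranscendental p hp).toAlgHom, by simp⟩

theorem ratFunc_algHom_algebraMap (j : RatFunc k →ₐ[k] W) (f : k[X]) :
    j (algebraMap k[X] (RatFunc k) f) = aeval (j RatFunc.X) f := by
  rw [Polynomial.aeval_algHom_apply, RatFunc.aeval_X_left_eq_algebraMap]

theorem exists_ratFunc_of_mem_adjoin_simple {j : RatFunc k →ₐ[k] W} {x : W}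
    (hx : x ∈ k⟮j RatFunc.X⟯) : ∃ φ, j φ = x := by
  obtain ⟨r, s, rfl⟩ := (mem_adjoin_simple_iff _ _).1 hx
  exact ⟨algebraMap _ _ r / algebraMap _ _ s, by simp [ratFunc_algHom_algebraMap]⟩

theorem exists_isSpecialization {p q : W} (h : AlgebraicIndependent k ![p, q]) :
    ∃ (V : ValuationSubring W) (j : RatFunc k →ₐ[k] W), j RatFunc.X = p ∧
      IsSpecialization V.valuation j q := by
  obtain ⟨hp, hq⟩ := algebraicIndependent_pair_iff.1 h
  obtain ⟨j, hj⟩ := exists_ratFunc_algHom hp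
  let A : Subring W := (Algebra.adjoin k⟮p⟯ {q}).toSubring
  have hqA : q ∈ A := Algebra.subset_adjoin rfl
  let I : Ideal A := Ideal.span {⟨q, hqA⟩}
  have hI : I ≠ ⊤ := by
    intro hI
    rw [Ideal.span_singleton_eq_top] at hI
    obtain ⟨⟨g, hg⟩, hmul⟩ := hI.exists_right_inv
    have hmul' : q * g = 1 := congrArg Subtype.val hmul
    have hg' : g ∈ Algebra.adjoin k⟮p⟯ {q} := hg
    rw [Algebra.adjoin_singleton_eq_range_aeval] at hg'
    obtain ⟨f, rfl⟩ := hg'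
    refine hq ⟨X * f - 1, ?_, by simp [show q * aeval q f = 1 from hmul']⟩
    intro h0
    have := congrArg (fun r => r.coeff 0) h0
    simp at this
  obtain ⟨V, hV, hVI⟩ := Ideal.image_subset_nonunits_valuationSubring I hI
  have hle : ∀ φ, V.valuation (j φ) ≤ 1 := by
    intro φ
    rw [ValuationSubring.valuation_le_one_iff]
    refine hV ?_
    have : j φ ∈ k⟮p⟯ := by
      rw [← RatFunc.num_div_denom φ, map_div₀, ratFunc_algHom_algebraMap,
        ratFunc_algHom_algebraMap, hj]
      exact (mem_adjoin_simple_iff _ _).2 ⟨_, _, rfl⟩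
    exact Subalgebra.algebraMap_mem (Algebra.adjoin k⟮p⟯ {q}) (⟨_, this⟩ : k⟮p⟯)
  refine ⟨V, j, hj, ⟨fun φ hφ => le_antisymm (hle φ) ?_, ?_, ?_⟩⟩
  · have := hle φ⁻¹
    rw [map_inv₀, map_inv₀] at this
    have h0 : 0 < V.valuation (j φ) := by simpa [zero_lt_iff] using hφ
    exact (inv_le_one₀ h0).1 this
  · rintro rfl
    exact hq isAlgebraic_zero
  · exact hVI ⟨⟨q, hqA⟩, Ideal.subset_span rfl, rfl⟩

namespace IsSpecialization

variable {Γ₀ : Type*} [LinearOrderedCommGroupWithZero Γ₀] {v : Valuation W Γ₀}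
  {j : RatFunc k →ₐ[k] W} {q : W}

theorem val_le_one (h : IsSpecialization v j q) (φ : RatFunc k) : v (j φ) ≤ 1 := by
  by_cases hφ : φ = 0
  · simp [hφ]
  · exact (h.val_eq_one φ hφ).le

theorem val_algebraMap (h : IsSpecialization v j q) (c : k) : v (algebraMap k W c) ≤ 1 := by
  rw [← j.commutes]
  exact h.val_le_one _

theorem val_aeval (h : IsSpecialization v j q) {f : k[X]} (hf : f ≠ 0) :
    v (aeval (j RatFunc.X) f) = 1 := by
  rw [← ratFunc_algHom_algebraMap]
  exact h.val_eq_one _ (by simpa using hf)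

theorem val_zpow_eq (h : IsSpecialization v j q) {n : ℤ} (hn : v q ^ n = 1) : n = 0 := by
  have h0 : v q ≠ 0 := by simpa using h.ne_zero
  by_contra hne
  rcases lt_or_gt_of_ne hne with hlt | hlt
  · have := zpow_right_strictAnti₀ (zero_lt_iff.2 h0) h.val_lt_one hlt
    simp [hn] at this
  · have := zpow_right_strictAnti₀ (zero_lt_iff.2 h0) h.val_lt_one hlt
    simp [hn] at this

theorem sameLead_iff (h : IsSpecialization v j q) {n n' : ℤ} {φ φ' : RatFunc k} (hφ : φ ≠ 0)
    (hφ' : φ' ≠ 0) :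
    SameLead v (q ^ n * j φ) (q ^ n' * j φ') ↔ n = n' ∧ φ = φ' := by
  constructor
  · intro hs
    have hv := hs.val_eq
    have hq0 : v q ≠ 0 := by simpa using h.ne_zero
    simp only [map_mul, map_zpow₀, h.val_eq_one _ hφ, h.val_eq_one _ hφ', mul_one] at hv
    have hn : n = n' := by
      have : v q ^ (n - n') = 1 := by
        rw [zpow_sub₀ hq0, hv, div_self (zpow_ne_zero _ hq0)]
      have := h.val_zpow_eq this
      omega
    subst hn
    refine ⟨rfl, ?_⟩
    by_contra hne
    unfold SameLead at hs
    rw [← mul_sub, ← map_sub, map_mul, map_mul, h.val_eq_one _ hφ',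
      h.val_eq_one _ (sub_ne_zero.2 hne)] at hs
    exact lt_irrefl _ hs
  · rintro ⟨rfl, rfl⟩
    exact SameLead.refl (mul_ne_zero (zpow_ne_zero _ h.ne_zero) (by simpa using hφ))

theorem exists_sameLead_aeval (h : IsSpecialization v j q) {K : IntermediateField k W}
    (hK : ∀ x ∈ K, ∃ φ, j φ = x) (f : Polynomial K) (hf : f ≠ 0) :
    ∃ (n : ℤ) (φ : RatFunc k), φ ≠ 0 ∧ SameLead v (aeval q f) (q ^ n * j φ) := by
  obtain ⟨g, hfg, hg⟩ := Polynomial.exists_eq_pow_rootMultiplicity_mul_and_not_dvd f hf 0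
  set n := f.rootMultiplicity 0
  rw [map_zero, sub_zero] at hfg hg
  obtain ⟨φ, hφ⟩ := hK (g.coeff 0) (g.coeff 0).2
  have hg0 : g.coeff 0 ≠ 0 := fun h0 => hg (X_dvd_iff.2 h0)
  have hφ0 : φ ≠ 0 := by
    rintro rfl
    rw [map_zero] at hφ
    exact hg0 (Subtype.ext hφ.symm)
  refine ⟨n, φ, hφ0, ?_⟩
  rw [hfg, map_mul, map_pow, aeval_X, zpow_natCast]
  refine (SameLead.refl (pow_ne_zero _ h.ne_zero)).mul ?_
  have hle : v (aeval q g.divX) ≤ 1 := by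
    have : aeval q g.divX ∈ v.integer := by
      rw [aeval_eq_sum_range]
      refine sum_mem fun i _ => ?_
      rw [Algebra.smul_def]
      refine mul_mem ?_ (pow_mem h.val_lt_one.le i)
      obtain ⟨ψ, hψ⟩ := hK _ (g.divX.coeff i).2
      change v _ ≤ 1
      rw [IntermediateField.algebraMap_apply, ← hψ]
      exact h.val_le_one ψ
    exact this
  have : aeval q g = j φ + q * aeval q g.divX := by
    conv_lhs => rw [← divX_mul_X_add g]
    simp [hφ, IntermediateField.algebraMap_apply]
    ring
  rw [this]
  refine SameLead.add_left ?_
  rw [h.val_eq_one _ hφ0, map_mul]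
  exact mul_lt_one_of_lt_of_le h.val_lt_one hle

theorem exists_sameLead (h : IsSpecialization v j q) {f : W}
    (hf : f ∈ adjoin k {j RatFunc.X, q}) (hf0 : f ≠ 0) :
    ∃ (n : ℤ) (φ : RatFunc k), φ ≠ 0 ∧ SameLead v f (q ^ n * j φ) := by
  have hf' : f ∈ k⟮j RatFunc.X⟯⟮q⟯ := by
    rw [← mem_restrictScalars k, adjoin_simple_adjoin_simple]
    exact hf
  obtain ⟨r, s, rfl⟩ := (mem_adjoin_simple_iff _ _).1 hf'
  have hr : r ≠ 0 := by rintro rfl; simp at hf0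
  have hs : s ≠ 0 := by rintro rfl; simp at hf0
  obtain ⟨n, φ, hφ, h1⟩ := h.exists_sameLead_aeval
    (fun x => exists_ratFunc_of_mem_adjoin_simple) r hr
  obtain ⟨n', φ', hφ', h2⟩ := h.exists_sameLead_aeval
    (fun x => exists_ratFunc_of_mem_adjoin_simple) s hs
  refine ⟨n - n', φ / φ', div_ne_zero hφ hφ', ?_⟩
  convert h1.div h2 using 1
  rw [zpow_sub₀ h.ne_zero, map_div₀]
  ring

end IsSpecialization

end Specialization

section RatFuncPlaces

open Polynomial IntermediateField WithZero

variable {k : Type*} [Field k]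

/-- The values of an element of `k(t)` under all valuations trivial on `k` with `v t < 1` are
the same power of `v t`. -/
theorem exists_val_eq_zpow {M : Type*} [Field M] [Algebra k M] {t f : M}
    (ht0 : t ≠ 0) (hf : f ∈ k⟮t⟯) (hf0 : f ≠ 0) :
    ∃ n : ℤ, ∀ v : Valuation M ℤᵐ⁰, (∀ c : k, c ≠ 0 → v (algebraMap k M c) = 1) →
      v t < 1 → v f = v t ^ n := by
  have key : ∀ g : k[X], g ≠ 0 → ∃ n : ℕ, ∀ v : Valuation M ℤᵐ⁰,
      (∀ c : k, c ≠ 0 → v (algebraMap k M c) = 1) → v t < 1 → v (aeval t g) = v t ^ n := by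
    intro g hg
    obtain ⟨h, hgh, hh⟩ := Polynomial.exists_eq_pow_rootMultiplicity_mul_and_not_dvd g hg 0
    set n := g.rootMultiplicity 0
    rw [map_zero, sub_zero] at hgh hh
    have hh0 : h.coeff 0 ≠ 0 := fun h0 => hh (X_dvd_iff.2 h0)
    refine ⟨n, fun v hv ht => ?_⟩
    suffices v (aeval t h) = 1 by
      rw [hgh, map_mul, map_pow, aeval_X, map_mul, this, mul_one, map_pow]
    have hle : v (aeval t h.divX) ≤ 1 := by
      have : aeval t h.divX ∈ v.integer := by
        rw [aeval_eq_sum_range]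
        refine sum_mem fun i _ => ?_
        rw [Algebra.smul_def]
        refine mul_mem ?_ (pow_mem ht.le i)
        change v _ ≤ 1
        by_cases hc : h.divX.coeff i = 0
        · simp [hc]
        · exact (hv _ hc).le
      exact this
    conv_lhs => rw [← divX_mul_X_add h]
    rw [map_add, aeval_C, Valuation.map_add_eq_of_lt_right, hv _ hh0]
    rw [hv _ hh0, map_mul, aeval_X, map_mul]
    exact mul_lt_one_of_nonneg_of_lt_one_right hle zero_le ht
  obtain ⟨r, s, rfl⟩ := (mem_adjoin_simple_iff _ _).1 hf
  have hr : r ≠ 0 := by rintro rfl; simp at hf0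
  have hs : s ≠ 0 := by rintro rfl; simp at hf0
  obtain ⟨n, hn⟩ := key r hr
  obtain ⟨m, hm⟩ := key s hs
  refine ⟨n - m, fun v hv ht => ?_⟩
  have ht0 : v t ≠ 0 := by simpa using ht0
  rw [map_div₀, hn v hv ht, hm v hv ht, zpow_sub₀ ht0, zpow_natCast, zpow_natCast]

theorem val_lt_one_iff_of_adjoin_eq_top {M : Type*} [Field M] [Algebra k M] {t : M} (ht0 : t ≠ 0)
    (htop : k⟮t⟯ = ⊤) {v v' : Valuation M ℤᵐ⁰} (hv : ∀ c : k, c ≠ 0 → v (algebraMap k M c) = 1)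
    (hv' : ∀ c : k, c ≠ 0 → v' (algebraMap k M c) = 1)
    (h : v t < 1 ∧ v' t < 1 ∨ 1 < v t ∧ 1 < v' t) (f : M) : v f < 1 ↔ v' f < 1 := by
  wlog hlt : v t < 1 generalizing t
  · have h1 : 1 < v t ∧ 1 < v' t := by tauto
    refine this (inv_ne_zero ht0) ?_ (.inl ?_) ?_
    · rw [eq_top_iff, ← htop, adjoin_simple_le_iff]
      simpa using inv_mem (mem_adjoin_simple_self k t⁻¹)
    · simpa [inv_lt_one_iff₀] using ⟨.inr h1.1, .inr h1.2⟩
    · simpa [inv_lt_one_iff₀] using .inr h1.1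
  have hlt' : v' t < 1 := h.elim And.right fun h => absurd h.1 hlt.not_gt
  by_cases hf0 : f = 0
  · simp [hf0]
  obtain ⟨n, hn⟩ := exists_val_eq_zpow (k := k) ht0 (htop ▸ mem_top) hf0
  have key (w : Valuation M ℤᵐ⁰) (hw : w t < 1) : w t ^ n < 1 ↔ 0 < n := by
    have : 0 < w t := by simpa [zero_lt_iff] using ht0
    rw [← zpow_zero (w t)]
    exact (zpow_right_strictAnti₀ this hw).lt_iff_gt
  rw [hn v hv hlt, hn v' hv' hlt', key v hlt, key v' hlt']

theorem exists_valuation_at (c : k) : ∃ v : Valuation (RatFunc k) ℤᵐ⁰,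
    (∀ a : k, a ≠ 0 → v (algebraMap k _ a) = 1) ∧
    ∀ f : k[X], f ≠ 0 → v (algebraMap k[X] _ f) = exp (-(f.rootMultiplicity c : ℤ)) := by
  have hirr : Irreducible (X - C c) := irreducible_X_sub_C c
  let P : IsDedekindDomain.HeightOneSpectrum k[X] :=
    ⟨Ideal.span {X - C c}, (Ideal.span_singleton_prime hirr.ne_zero).2 hirr.prime,
      by simpa using hirr.ne_zero⟩
  have h1 : ∀ f : k[X], f.eval c ≠ 0 → P.valuation (RatFunc k) (algebraMap _ _ f) = 1 := by
    intro f hf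
    rw [IsDedekindDomain.HeightOneSpectrum.valuation_eq_one_iff_notMem]
    rwa [Ideal.mem_span_singleton, dvd_iff_isRoot]
  refine ⟨P.valuation _, fun a ha => ?_, fun f hf => ?_⟩
  · rw [IsScalarTower.algebraMap_apply k k[X] (RatFunc k)]
    exact h1 _ (by simpa using ha)
  · obtain ⟨g, hfg, hg⟩ := Polynomial.exists_eq_pow_rootMultiplicity_mul_and_not_dvd f hf c
    set n := f.rootMultiplicity c
    rw [hfg, map_mul, map_mul, h1 g (by rwa [dvd_iff_isRoot] at hg), map_pow, map_pow,
      IsDedekindDomain.HeightOneSpectrum.valuation_of_algebraMap,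
      P.intValuation_singleton hirr.ne_zero rfl, mul_one, ← exp_nsmul]
    simp

theorem exists_valuation_infty : ∃ v : Valuation (RatFunc k) ℤᵐ⁰,
    (∀ a : k, a ≠ 0 → v (algebraMap k _ a) = 1) ∧
    ∀ f : k[X], f ≠ 0 → v (algebraMap k[X] _ f) = exp (f.natDegree : ℤ) := by
  classical
  refine ⟨RatFunc.inftyValuation k, fun a ha => ?_, fun f hf =>
    RatFunc.inftyValuation.polynomial k hf⟩
  rw [RatFunc.algebraMap_eq_C]
  exact RatFunc.inftyValuation.C k ha

/-- A generator of `k(X)` cannot have nonzero order at three places. -/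
theorem false_of_three_places {t : RatFunc k} (ht0 : t ≠ 0) (htop : k⟮t⟯ = ⊤) {c : k} (hc : c ≠ 0)
    {v₀ v₁ v₂ : Valuation (RatFunc k) ℤᵐ⁰}
    (h₀ : ∀ a : k, a ≠ 0 → v₀ (algebraMap k _ a) = 1)
    (h₀' : ∀ f : k[X], f ≠ 0 → v₀ (algebraMap k[X] _ f) = exp (-(f.rootMultiplicity 0 : ℤ)))
    (h₁ : ∀ a : k, a ≠ 0 → v₁ (algebraMap k _ a) = 1)
    (h₁' : ∀ f : k[X], f ≠ 0 → v₁ (algebraMap k[X] _ f) = exp (-(f.rootMultiplicity c : ℤ)))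
    (h₂ : ∀ a : k, a ≠ 0 → v₂ (algebraMap k _ a) = 1)
    (h₂' : ∀ f : k[X], f ≠ 0 → v₂ (algebraMap k[X] _ f) = exp (f.natDegree : ℤ))
    (ht₀ : v₀ t ≠ 1) (ht₁ : v₁ t ≠ 1) (ht₂ : v₂ t ≠ 1) : False := by
  have hX : (X : k[X]) ≠ 0 := X_ne_zero
  have hXc : (X - C c : k[X]) ≠ 0 := X_sub_C_ne_zero c
  have r0 : (X : k[X]).rootMultiplicity 0 = 1 := by
    simpa using rootMultiplicity_X_sub_C_self (x := (0 : k))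
  have r1 : (X : k[X]).rootMultiplicity c = 0 := rootMultiplicity_eq_zero (by simpa using hc)
  have r2 : (X - C c).rootMultiplicity 0 = 0 := rootMultiplicity_eq_zero (by simpa using hc)
  have r3 : (X - C c).rootMultiplicity c = 1 := rootMultiplicity_X_sub_C_self
  have a1 := h₀' X hX
  have a2 := h₁' X hX
  have a3 := h₂' X hX
  have b1 := h₀' _ hXc
  have b2 := h₁' _ hXc
  have b3 := h₂' _ hXc
  simp only [r0, r1, r2, r3, natDegree_X, natDegree_X_sub_C] at a1 a2 a3 b1 b2 b3
  have hlt : (exp (-1) : ℤᵐ⁰) < 1 := by rw [← exp_zero, exp_lt_exp]; norm_num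
  have hgt : ¬ (exp 1 : ℤᵐ⁰) < 1 := by rw [← exp_zero, exp_lt_exp]; norm_num
  have n02 : ¬ (v₀ t < 1 ∧ v₂ t < 1 ∨ 1 < v₀ t ∧ 1 < v₂ t) := fun h => by
    have := val_lt_one_iff_of_adjoin_eq_top ht0 htop h₀ h₂ h (algebraMap k[X] _ X)
    rw [a1, a3] at this
    exact hgt (this.1 hlt)
  have n12 : ¬ (v₁ t < 1 ∧ v₂ t < 1 ∨ 1 < v₁ t ∧ 1 < v₂ t) := fun h => by
    have := val_lt_one_iff_of_adjoin_eq_top ht0 htop h₁ h₂ h (algebraMap k[X] _ (X - C c))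
    rw [b2, b3] at this
    exact hgt (this.1 hlt)
  have n01 : ¬ (v₀ t < 1 ∧ v₁ t < 1 ∨ 1 < v₀ t ∧ 1 < v₁ t) := fun h => by
    have := val_lt_one_iff_of_adjoin_eq_top ht0 htop h₀ h₁ h (algebraMap k[X] _ X)
    rw [a1, a2] at this
    simpa using this.1 hlt
  rcases lt_or_gt_of_ne ht₀ with h | h <;> rcases lt_or_gt_of_ne ht₁ with h' | h' <;>
    rcases lt_or_gt_of_ne ht₂ with h'' | h''
  all_goals first
    | exact n02 (.inl ⟨h, h''⟩)
    | exact n02 (.inr ⟨h, h''⟩)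
    | exact n12 (.inl ⟨h', h''⟩)
    | exact n12 (.inr ⟨h', h''⟩)
    | exact n01 (.inl ⟨h, h'⟩)
    | exact n01 (.inr ⟨h, h'⟩)

end RatFuncPlaces

section KeyPolynomial

open Polynomial

variable {K W Γ₀ : Type*} [Field K] [Field W] [Algebra K W] [IsAlgClosed W]
  [LinearOrderedCommGroupWithZero Γ₀] {v : Valuation W Γ₀} {τ α : W}

/-- If `τ` has a best approximation algebraic over `K`, there is a monic key polynomial `Q`:
polynomials of smaller degree take values at `τ` with algebraic leading term, while nonzero
multiples of `Q` do not. -/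
theorem exists_keyPolynomial (h : ∃ α, IsBestApprox K v τ α) :
    ∃ Q : K[X], Q.Monic ∧ 0 < Q.natDegree ∧
      (∀ f : K[X], f ≠ 0 → f.natDegree < Q.natDegree →
        ∃ μ, IsAlgebraic K μ ∧ SameLead v (aeval τ f) μ) ∧
      ∀ f : K[X], f ≠ 0 → ∀ μ, IsAlgebraic K μ → ¬ SameLead v (aeval τ (f * Q)) μ := by
  obtain ⟨α, hα, hmin⟩ := WellFounded.has_min
    (InvImage.wf (fun α : W => (minpoly K α).natDegree) wellFounded_lt)
    {α | IsBestApprox K v τ α} h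
  have hα' : IsBestApprox K v τ α := hα
  have hInt : IsIntegral K α := hα'.1.isIntegral
  refine ⟨minpoly K α, minpoly.monic hInt, minpoly.natDegree_pos hInt, fun f hf hdeg => ?_,
    fun f hf μ hμ => ?_⟩
  · refine ⟨aeval α f, ?_, sameLead_aeval hf fun β hβ => ?_⟩
    · exact isAlgebraic_iff_isIntegral.2 (.of_mem_of_fg _ hInt.fg_adjoin_singleton _
        (aeval_mem_adjoin_singleton _ _))
    · by_contra! hle
      rw [mem_aroots] at hβ
      refine hmin β ⟨⟨f, hβ⟩, fun γ hγ => le_trans ?_ (hα'.2 γ hγ)⟩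
        ((natDegree_le_of_dvd (minpoly.dvd K β hβ.2) hf).trans_lt hdeg)
      have : τ - β = (τ - α) - (β - α) := by ring
      rw [this]
      exact v.map_sub_le le_rfl hle
  · refine hα'.not_sameLead (β := α) ?_ (mul_ne_zero hf (minpoly.ne_zero hInt)) (by simp) hμ
    simp

end KeyPolynomial

section LeadingTerms

open Polynomial IntermediateField WithZero

variable {k W Γ₀ : Type*} [Field k] [Field W] [Algebra k W]
  [LinearOrderedCommGroupWithZero Γ₀] {v : Valuation W Γ₀}

theorem Valuation.aeval_sub_aeval_lt_one (hk : ∀ c : k, v (algebraMap k W c) ≤ 1) {a b : W}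
    (ha : v a ≤ 1) (hb : v b ≤ 1) (hab : v (a - b) < 1) (p : k[X]) :
    v (aeval a p - aeval b p) < 1 := by
  induction p using Polynomial.induction_on' with
  | add p q hp hq =>
    rw [map_add, map_add, add_sub_add_comm]
    exact v.map_add_lt hp hq
  | monomial n c =>
    rw [aeval_monomial, aeval_monomial, ← mul_sub, map_mul]
    refine mul_lt_one_of_nonneg_of_lt_one_right (hk c) zero_le ?_
    induction n with
    | zero => simp
    | succ n ih =>
      have : a ^ (n + 1) - b ^ (n + 1) = a ^ n * (a - b) + (a ^ n - b ^ n) * b := by ring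
      rw [this]
      refine v.map_add_lt ?_ ?_
      · rw [map_mul, map_pow]
        exact mul_lt_one_of_nonneg_of_lt_one_right (pow_le_one₀ zero_le ha) zero_le hab
      · rw [map_mul]
        exact mul_lt_one_of_nonneg_of_lt_one_left zero_le ih hb

variable {j : RatFunc k →ₐ[k] W} {z F : W}

/-- The monomial `z ^ n * j ψ` is the leading term of an element algebraic over `k(F)`. -/
def IsAlgLead (v : Valuation W Γ₀) (j : RatFunc k →ₐ[k] W) (z F : W) (n : ℤ) (ψ : RatFunc k) :
    Prop :=
  ∃ μ, IsAlgebraic k⟮F⟯ μ ∧ SameLead v (z ^ n * j ψ) μ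

namespace IsAlgLead

variable {n n' : ℤ} {ψ ψ' : RatFunc k}

theorem ne_zero (h : IsAlgLead v j z F n ψ) : ψ ≠ 0 := by
  obtain ⟨μ, -, h⟩ := h
  rintro rfl
  simpa using h.ne_zero_left

theorem mul (hz : z ≠ 0) (h : IsAlgLead v j z F n ψ) (h' : IsAlgLead v j z F n' ψ') :
    IsAlgLead v j z F (n + n') (ψ * ψ') := by
  obtain ⟨μ, hμ, hs⟩ := h
  obtain ⟨μ', hμ', hs'⟩ := h'
  refine ⟨μ * μ', hμ.mul hμ', ?_⟩
  convert hs.mul hs' using 1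
  rw [zpow_add₀ hz, map_mul]
  ring

theorem zpow (h : IsAlgLead v j z F n ψ) (m : ℤ) : IsAlgLead v j z F (m * n) (ψ ^ m) := by
  obtain ⟨μ, hμ, hs⟩ := h
  refine ⟨μ ^ m, ?_, ?_⟩
  · rw [← mem_algebraicClosure_iff] at hμ ⊢
    exact zpow_mem hμ m
  · convert hs.zpow m using 1
    rw [mul_zpow, ← zpow_mul, mul_comm m n, map_zpow₀]

theorem inv (h : IsAlgLead v j z F n ψ) : IsAlgLead v j z F (-n) ψ⁻¹ := by
  simpa using h.zpow (-1)

theorem one : IsAlgLead v j z F 0 1 :=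
  ⟨1, isAlgebraic_one, by simpa using SameLead.refl one_ne_zero⟩

theorem exists_eq_C (hs : IsSpecialization v j z) (hF : 1 < v F)
    (h : IsAlgLead v j z F 0 ψ) : ∃ c, ψ = RatFunc.C c := by
  have hψ := h.ne_zero
  obtain ⟨μ, hμ, hsl⟩ := h
  rw [zpow_zero, one_mul] at hsl
  have hv := hsl.val_eq
  rw [hs.val_eq_one _ hψ] at hv
  obtain ⟨p, hp, hlt⟩ := exists_aeval_lt_one hF hv.ge hs.val_algebraMap hμ
  have h1 : v (aeval (j ψ) p) < 1 := by
    have h2 := Valuation.aeval_sub_aeval_lt_one hs.val_algebraMap (hs.val_le_one ψ) hv.ge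
      (hsl.trans_eq hv.symm) p
    rw [← sub_add_cancel (aeval (j ψ) p) (aeval μ p)]
    exact v.map_add_lt h2 hlt
  rw [aeval_algHom_apply] at h1
  have h0 : aeval ψ p = 0 := by
    by_contra hne
    exact h1.ne (hs.val_eq_one _ hne)
  by_contra hC
  exact RatFunc.transcendental_of_ne_C ψ hC ⟨p, hp, h0⟩

end IsAlgLead

theorem IsSpecialization.sameLead_add (hs : IsSpecialization v j z) {a b : W} {n : ℤ}
    {ψ ψ' : RatFunc k} (h : SameLead v a (z ^ n * j ψ)) (h' : SameLead v b (z ^ n * j ψ'))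
    (hne : ψ + ψ' ≠ 0) : SameLead v (a + b) (z ^ n * j (ψ + ψ')) := by
  have hψ : ψ ≠ 0 := by rintro rfl; simpa using h.ne_zero_right
  have hψ' : ψ' ≠ 0 := by rintro rfl; simpa using h'.ne_zero_right
  unfold SameLead at *
  have : a + b - z ^ n * j (ψ + ψ') = (a - z ^ n * j ψ) + (b - z ^ n * j ψ') := by
    rw [map_add]; ring
  rw [this]
  refine v.map_add_lt ?_ ?_
  · rwa [map_mul, hs.val_eq_one _ hne, ← hs.val_eq_one _ hψ, ← map_mul]
  · rwa [map_mul, hs.val_eq_one _ hne, ← hs.val_eq_one _ hψ', ← map_mul]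

end LeadingTerms

section ResidueGenerator

open Polynomial IntermediateField WithZero

variable {k W Γ₀ : Type*} [Field k] [Field W] [Algebra k W] [IsAlgClosed W]
  [LinearOrderedCommGroupWithZero Γ₀] {v : Valuation W Γ₀}
  {j : RatFunc k →ₐ[k] W} {z F τ : W}

theorem exists_keyPolynomial_of_isSpecialization (hs : IsSpecialization v j z) (hF : 1 < v F)
    (hu : j RatFunc.X ∈ k⟮F⟯⟮τ⟯) :
    Transcendental k⟮F⟯ τ ∧ ∃ α, IsBestApprox k⟮F⟯ v τ α := by
  have hX0 : j RatFunc.X ≠ 0 := by simpa using RatFunc.X_ne_zero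
  have hnot : ∀ μ, IsAlgebraic k⟮F⟯ μ → ¬ SameLead v (j RatFunc.X) μ := by
    intro μ hμ hsl
    obtain ⟨c, hc⟩ := IsAlgLead.exists_eq_C (ψ := RatFunc.X) hs hF ⟨μ, hμ, by simpa using hsl⟩
    have := RatFunc.transcendental_X (K := k)
    rw [hc] at this
    exact this (isAlgebraic_algebraMap c)
  constructor
  · intro hτ
    have : IsAlgebraic k⟮F⟯ (j RatFunc.X) := by
      have := isAlgebraic_adjoin_simple hτ.isIntegral
      have := this.isAlgebraic ⟨_, hu⟩
      rwa [IntermediateField.isAlgebraic_iff] at this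
    exact hnot _ this (SameLead.refl hX0)
  · obtain ⟨r, s, hrs⟩ := (mem_adjoin_simple_iff _ _).1 hu
    rw [hrs] at hnot hX0
    exact exists_isBestApprox (div_ne_zero_iff.1 hX0).1 (div_ne_zero_iff.1 hX0).2 hnot

/-- Let `k(F, τ) = k(u, z)` and suppose that `F` has leading term `z ^ (-N) * φ(u)` with `N > 0`.
Then the residue field `k(u)` has a generator `t` over `k` which has nonzero order at all places at
which the order of `φ` is not divisible by `N`. -/
theorem exists_residue_generator (hs : IsSpecialization v j z)
    (hL : adjoin k {F, τ} = adjoin k {j RatFunc.X, z}) {N : ℕ} (hN : 0 < N) {φ : RatFunc k}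
    (hF : SameLead v F (z ^ (-N : ℤ) * j φ)) :
    ∃ t : RatFunc k, t ≠ 0 ∧ k⟮t⟯ = ⊤ ∧ ∀ w : Valuation (RatFunc k) ℤᵐ⁰,
      (∀ a : k, a ≠ 0 → w (algebraMap k _ a) = 1) → ¬ (N : ℤ) ∣ log (w φ) → w t ≠ 1 := by
  have hz := hs.ne_zero
  have hφ : φ ≠ 0 := by rintro rfl; simpa using hF.ne_zero_right
  have hF1 : 1 < v F := by
    rw [hF.val_eq, map_mul, hs.val_eq_one _ hφ, mul_one, map_zpow₀, zpow_neg, zpow_natCast]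
    refine (one_lt_inv₀ (pow_pos (zero_lt_iff.2 (by simpa using hz)) _)).2 ?_
    exact pow_lt_one₀ zero_le hs.val_lt_one hN.ne'
  have hmem (f : W) : f ∈ k⟮F⟯⟮τ⟯ ↔ f ∈ adjoin k {j RatFunc.X, z} := by
    rw [← mem_restrictScalars k, adjoin_simple_adjoin_simple, hL]
  have hu : j RatFunc.X ∈ k⟮F⟯⟮τ⟯ := (hmem _).2 (subset_adjoin _ _ (by simp))
  obtain ⟨hτ, hbest⟩ := exists_keyPolynomial_of_isSpecialization hs hF1 hu
  obtain ⟨Q, hQm, hQpos, hsmall, hQ⟩ := exists_keyPolynomial hbest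
  have hne (f : k⟮F⟯[X]) (hf : f ≠ 0) : aeval τ f ≠ 0 := fun h => hτ ⟨f, hf, h⟩
  have hlead (f : k⟮F⟯[X]) (hf : f ≠ 0) :
      ∃ (n : ℤ) (φ : RatFunc k), φ ≠ 0 ∧ SameLead v (aeval τ f) (z ^ n * j φ) :=
    hs.exists_sameLead ((hmem _).1 ((mem_adjoin_simple_iff _ _).2 ⟨f, 1, by simp⟩)) (hne f hf)
  obtain ⟨q, χ, hχ, hQlead⟩ := hlead Q hQm.ne_zero
  have hFG : IsAlgLead v j z F (-N) φ :=
    ⟨F, isAlgebraic_algebraMap (AdjoinSimple.gen k F), hF.symm⟩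
  -- the order `m` of the value of `Q` modulo values of algebraic elements
  have hex : ∃ m : ℕ, 0 < m ∧ ∃ γ, IsAlgLead v j z F (m * q) γ := by
    refine ⟨N, hN, φ ^ (-q), ?_⟩
    have := hFG.zpow (-q)
    convert this using 1
    ring
  classical
  obtain ⟨hmpos, γ₀, hγ₀⟩ := Nat.find_spec hex
  have hmin : ∀ r : ℕ, r < Nat.find hex → ∀ γ, IsAlgLead v j z F (r * q) γ → r = 0 := by
    intro r hr γ hγ
    by_contra h0
    exact Nat.find_min hex hr ⟨Nat.pos_of_ne_zero h0, γ, hγ⟩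
  set m := Nat.find hex
  have hγ₀0 := hγ₀.ne_zero
  let t : RatFunc k := χ ^ m / γ₀
  have ht0 : t ≠ 0 := div_ne_zero (pow_ne_zero _ hχ) hγ₀0
  -- the group of leading terms
  let H (n : ℤ) (ψ : RatFunc k) : Prop := ∃ (g : ℤ) (γ : RatFunc k) (s : ℤ) (ε : RatFunc k),
    IsAlgLead v j z F g γ ∧ ε ∈ k⟮t⟯ ∧ ε ≠ 0 ∧ n = g + s * q ∧ ψ = γ * χ ^ s * ε
  have hH_mul {n n' : ℤ} {ψ ψ' : RatFunc k} : H n ψ → H n' ψ' → H (n + n') (ψ * ψ') := by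
    rintro ⟨g, γ, s, ε, hg, hε, hε0, rfl, rfl⟩ ⟨g', γ', s', ε', hg', hε', hε0', rfl, rfl⟩
    refine ⟨g + g', γ * γ', s + s', ε * ε', hg.mul hz hg', mul_mem hε hε', mul_ne_zero hε0 hε0',
      by ring, ?_⟩
    rw [zpow_add₀ hχ]
    ring
  have hH_inv {n : ℤ} {ψ : RatFunc k} : H n ψ → H (-n) ψ⁻¹ := by
    rintro ⟨g, γ, s, ε, hg, hε, hε0, rfl, rfl⟩
    refine ⟨-g, γ⁻¹, -s, ε⁻¹, hg.inv, inv_mem hε, inv_ne_zero hε0, by ring, ?_⟩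
    rw [mul_inv, mul_inv, zpow_neg]
  have hH_alg {n : ℤ} {ψ : RatFunc k} (h : IsAlgLead v j z F n ψ) : H n ψ :=
    ⟨n, ψ, 0, 1, h, one_mem _, one_ne_zero, by ring, by simp⟩
  have hHQ : H q χ := ⟨0, 1, 1, 1, .one, one_mem _, one_ne_zero, by ring, by simp⟩
  have hH_zero {ψ : RatFunc k} : H 0 ψ → ψ ∈ k⟮t⟯ := by
    rintro ⟨g, γ, s, ε, hg, hε, hε0, h0, rfl⟩
    have hdvd : s % m = 0 := by
      have hr0 : 0 ≤ s % m := Int.emod_nonneg _ (by omega)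
      have hr1 : s % m < m := Int.emod_lt_of_pos _ (by omega)
      have h1 := hg.inv.mul hz (hγ₀.zpow (-(s / m)))
      have h2 : -g + -(s / m) * (m * q) = (s % m).toNat * q := by
        rw [Int.toNat_of_nonneg hr0]
        have := Int.emod_add_mul_ediv s m
        linear_combination h0 - q * this
      rw [h2] at h1
      have := hmin _ (by omega) _ h1
      omega
    obtain ⟨r, rfl⟩ := Int.dvd_of_emod_eq_zero hdvd
    have h1 := hg.mul hz (hγ₀.zpow r)
    have h2 : g + r * (m * q) = 0 := by linear_combination -h0
    rw [h2] at h1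
    obtain ⟨c, hc⟩ := h1.exists_eq_C hs hF1
    have h3 : γ * χ ^ (m * r) * ε = RatFunc.C c * t ^ r * ε := by
      rw [← hc, div_zpow, zpow_mul, zpow_natCast]
      field_simp
    rw [h3]
    exact mul_mem (mul_mem (k⟮t⟯.algebraMap_mem c) (zpow_mem (mem_adjoin_simple_self k t) r)) hε
  have hH_poly : ∀ (d : ℕ) (f : k⟮F⟯[X]), f.natDegree < d → f ≠ 0 →
      ∃ n ψ, SameLead v (aeval τ f) (z ^ n * j ψ) ∧ H n ψ := by
    intro d
    induction d with
    | zero => intro f hf; omega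
    | succ d ih =>
      intro f hfd hf0
      have hsmall' : ∀ f : k⟮F⟯[X], f ≠ 0 → f.natDegree < Q.natDegree →
          ∃ n ψ, SameLead v (aeval τ f) (z ^ n * j ψ) ∧ IsAlgLead v j z F n ψ := by
        intro f hf0 hdeg
        obtain ⟨n, ψ, -, hl⟩ := hlead f hf0
        obtain ⟨μ, hμ, hl'⟩ := hsmall f hf0 hdeg
        exact ⟨n, ψ, hl, μ, hμ, hl.symm.trans hl'⟩
      by_cases hdeg : f.natDegree < Q.natDegree
      · obtain ⟨n, ψ, hl, ha⟩ := hsmall' f hf0 hdeg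
        exact ⟨n, ψ, hl, hH_alg ha⟩
      have hdiv := modByMonic_add_div f Q
      set f₀ := f %ₘ Q
      set f₁ := f /ₘ Q
      have hf₁deg : f₁.natDegree = f.natDegree - Q.natDegree := natDegree_divByMonic f hQm
      have hf₁0 : f₁ ≠ 0 := by
        intro h0
        rw [h0, mul_zero, add_zero] at hdiv
        have := natDegree_modByMonic_lt f hQm (by rintro rfl; simp at hQpos)
        rw [show f %ₘ Q = f from hdiv] at this
        exact hdeg this
      obtain ⟨n₁, ψ₁, hl₁, hH₁⟩ := ih f₁ (by omega) hf₁0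
      have hl₁Q : SameLead v (aeval τ (f₁ * Q)) (z ^ (n₁ + q) * j (ψ₁ * χ)) := by
        rw [map_mul]
        convert hl₁.mul hQlead using 1
        rw [zpow_add₀ hz, map_mul]
        ring
      have hH₁Q := hH_mul hH₁ hHQ
      have hsum : aeval τ f = aeval τ (f₁ * Q) + aeval τ f₀ := by
        rw [← map_add, mul_comm f₁, add_comm, hdiv]
      by_cases hf₀0 : f₀ = 0
      · exact ⟨_, _, by simpa [hsum, hf₀0] using hl₁Q, hH₁Q⟩
      obtain ⟨n₀, ψ₀, hl₀, hH₀⟩ := hsmall' f₀ hf₀0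
        (natDegree_modByMonic_lt f hQm (by rintro rfl; simp at hQpos))
      rw [hsum]
      rcases lt_trichotomy (v (aeval τ (f₁ * Q))) (v (aeval τ f₀)) with hlt | heq | hgt
      · exact ⟨n₀, ψ₀, by rw [add_comm]; exact (SameLead.add_left hlt).trans hl₀, hH_alg hH₀⟩
      · have hn : n₁ + q = n₀ := by
          have hψ₁ : ψ₁ * χ ≠ 0 := by
            intro h0
            simpa [h0] using hl₁Q.ne_zero_right
          rw [hl₁Q.val_eq, hl₀.val_eq, map_mul v, map_mul v, hs.val_eq_one _ hψ₁,
            hs.val_eq_one _ hH₀.ne_zero, mul_one, mul_one, map_zpow₀, map_zpow₀] at heq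
          have h0 : v z ≠ 0 := by simpa using hz
          have := hs.val_zpow_eq (n := n₁ + q - n₀)
            (by rw [zpow_sub₀ h0, heq, div_self (zpow_ne_zero _ h0)])
          omega
        rw [hn] at hl₁Q hH₁Q
        have hψ₀ := hH₀.ne_zero
        have hε : ψ₁ * χ / ψ₀ ∈ k⟮t⟯ := by
          refine hH_zero ?_
          have := hH_mul hH₁Q (hH_inv (hH_alg hH₀))
          rwa [add_neg_cancel, ← div_eq_mul_inv] at this
        have hne0 : ψ₁ * χ + ψ₀ ≠ 0 := by
          intro h0
          obtain ⟨μ, hμ, hμl⟩ := hH₀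
          refine hQ f₁ hf₁0 (-μ) hμ.neg (hl₁Q.trans ?_)
          rw [eq_neg_of_add_eq_zero_left h0, map_neg, mul_neg]
          unfold SameLead at *
          rwa [← neg_sub_neg, neg_neg, neg_neg, Valuation.map_neg, Valuation.map_sub_swap]
        refine ⟨n₀, ψ₁ * χ + ψ₀, hs.sameLead_add hl₁Q hl₀ hne0, n₀, ψ₀, 0, ψ₁ * χ / ψ₀ + 1, hH₀,
          add_mem hε (one_mem _), ?_, by ring, ?_⟩
        · intro h0
          apply hne0
          field_simp at h0
          simpa using h0
        · field_simp
      · exact ⟨_, _, (SameLead.add_left hgt).trans hl₁Q, hH₁Q⟩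
  have hH_all {n : ℤ} {ψ : RatFunc k} (hψ : ψ ≠ 0)
      (h : z ^ n * j ψ ∈ adjoin k {j RatFunc.X, z}) : H n ψ := by
    have h0 : z ^ n * j ψ ≠ 0 := mul_ne_zero (zpow_ne_zero _ hz) (by simpa using hψ)
    obtain ⟨r, s, hrs⟩ := (mem_adjoin_simple_iff _ _).1 ((hmem _).2 h)
    have hr : r ≠ 0 := by rintro rfl; exact h0 (by rw [hrs]; simp)
    have hs0 : s ≠ 0 := by rintro rfl; exact h0 (by rw [hrs]; simp)
    obtain ⟨n₁, ψ₁, hl₁, hH₁⟩ := hH_poly _ r (Nat.lt_succ_self _) hr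
    obtain ⟨n₂, ψ₂, hl₂, hH₂⟩ := hH_poly _ s (Nat.lt_succ_self _) hs0
    have hψ₁ : ψ₁ ≠ 0 := by rintro rfl; simpa using hl₁.ne_zero_right
    have hψ₂ : ψ₂ ≠ 0 := by rintro rfl; simpa using hl₂.ne_zero_right
    have h12 : SameLead v (z ^ n * j ψ) (z ^ (n₁ + -n₂) * j (ψ₁ * ψ₂⁻¹)) := by
      rw [hrs]
      convert hl₁.div hl₂ using 1
      rw [zpow_add₀ hz, zpow_neg, map_mul, map_inv₀]
      field_simp
    obtain ⟨rfl, rfl⟩ := (hs.sameLead_iff hψ (mul_ne_zero hψ₁ (inv_ne_zero hψ₂))).1 h12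
    exact hH_mul hH₁ (hH_inv hH₂)
  refine ⟨t, ht0, ?_, fun w hw hdvd hwt => hdvd ?_⟩
  · refine eq_top_iff.2 fun ψ _ => ?_
    by_cases hψ : ψ = 0
    · rw [hψ]; exact zero_mem _
    refine hH_zero (hH_all hψ ?_)
    rw [zpow_zero, one_mul]
    have : j ψ ∈ k⟮j RatFunc.X⟯ := by
      rw [← RatFunc.num_div_denom ψ, map_div₀, ratFunc_algHom_algebraMap,
        ratFunc_algHom_algebraMap]
      exact (mem_adjoin_simple_iff _ _).2 ⟨_, _, rfl⟩
    exact adjoin.mono k _ _ (by simp) this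
  · have hw0 {ψ : RatFunc k} (hψ : ψ ≠ 0) : w ψ ≠ 0 := by simpa using hψ
    have hD : ∀ {g : ℤ} {γ : RatFunc k}, IsAlgLead v j z F g γ →
        N * log (w γ) + g * log (w φ) = 0 := by
      intro g γ hg
      have h1 := (hg.zpow N).mul hz (hFG.zpow g)
      rw [show N * g + g * -N = (0 : ℤ) by ring] at h1
      obtain ⟨c, hc⟩ := h1.exists_eq_C hs hF1
      have hc0 : c ≠ 0 := by
        rintro rfl
        exact h1.ne_zero (by simpa using hc)
      have := congrArg (fun ψ => log (w ψ)) hc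
      simp only [map_mul, map_zpow₀] at this
      rw [log_mul (zpow_ne_zero _ (hw0 hg.ne_zero)) (zpow_ne_zero _ (hw0 hφ)), log_zpow, log_zpow,
        ← RatFunc.algebraMap_eq_C, hw c hc0, log_one] at this
      simpa using this
    have hDt : m * log (w χ) = log (w γ₀) := by
      have := congrArg log hwt
      rw [map_div₀, log_div (hw0 (pow_ne_zero _ hχ)) (hw0 hγ₀0), map_pow, log_pow, log_one] at this
      simpa [sub_eq_zero] using this
    have hDχ : N * log (w χ) + q * log (w φ) = 0 := by
      have h1 := hD hγ₀
      have hm0 : (m : ℤ) ≠ 0 := by omega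
      refine mul_left_cancel₀ hm0 ?_
      linear_combination h1 + N * hDt
    obtain ⟨g, γ, s, ε, hg, -, hε0, h1, h2⟩ := hH_all (n := 1) (ψ := 1) one_ne_zero (by
      simpa using subset_adjoin k _ (by simp))
    have h3 := congrArg (fun ψ => log (w ψ)) h2
    simp only [map_mul, map_zpow₀, map_one, log_one] at h3
    rw [log_mul (mul_ne_zero (hw0 hg.ne_zero) (zpow_ne_zero _ (hw0 hχ))) (hw0 hε0),
      log_mul (hw0 hg.ne_zero) (zpow_ne_zero _ (hw0 hχ)), log_zpow] at h3
    simp only [smul_eq_mul] at h3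
    refine ⟨log (w ε), ?_⟩
    linear_combination log (w φ) * h1 + N * h3 + (hD hg) + s * hDχ

end ResidueGenerator

section GeneratingPairs

open IntermediateField

variable {k M : Type*} [Field k] [Field M] [Algebra k M] {a b c d : M}

theorem AlgebraicIndependent.pair_of_adjoin_eq_top (h : AlgebraicIndependent k ![c, d])
    (hab : adjoin k {a, b} = ⊤) : AlgebraicIndependent k ![a, b] := by
  have : Algebra.IsAlgebraic (Algebra.adjoin k (Set.range ![a, b])) M := by
    refine ⟨fun x => ?_⟩
    have hx : x ∈ adjoin k (Set.range ![a, b]) := by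
      rw [Matrix.range_cons_cons_empty, hab]
      trivial
    obtain ⟨r, hr', s, hs', rfl⟩ := mem_adjoin_iff_div.1 hx
    have hr := isAlgebraic_algebraMap (R := Algebra.adjoin k (Set.range ![a, b])) (A := M) ⟨r, hr'⟩
    have hs := isAlgebraic_algebraMap (R := Algebra.adjoin k (Set.range ![a, b])) (A := M) ⟨s, hs'⟩
    rw [div_eq_mul_inv]
    exact hr.mul hs.inv
  exact (Algebra.IsAlgebraic.isTranscendenceBasis_of_lift_le_trdeg_of_finite k ![a, b]
    h.lift_cardinalMk_le_trdeg).1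

theorem AlgebraicIndependent.pair_of_adjoin_le (h : AlgebraicIndependent k ![c, d])
    (hab : adjoin k {c, d} ≤ adjoin k {a, b}) : AlgebraicIndependent k ![a, b] := by
  set E := adjoin k {a, b}
  have ha : a ∈ E := subset_adjoin _ _ (by simp)
  have hb : b ∈ E := subset_adjoin _ _ (by simp)
  have hc : c ∈ E := hab (subset_adjoin _ _ (by simp))
  have hd : d ∈ E := hab (subset_adjoin _ _ (by simp))
  have h' : AlgebraicIndependent k ![(⟨c, hc⟩ : E), ⟨d, hd⟩] := by
    refine AlgebraicIndependent.of_comp E.val ?_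
    convert h using 1
    ext i; fin_cases i <;> rfl
  have htop : adjoin k {(⟨a, ha⟩ : E), ⟨b, hb⟩} = ⊤ := by
    refine map_injective E.val ?_
    rw [adjoin_map, Set.image_pair, ← AlgHom.fieldRange_eq_map, fieldRange_val]
    rfl
  have := (h'.pair_of_adjoin_eq_top htop).map' (f := E.val) E.val.injective
  convert this using 1
  ext i; fin_cases i <;> rfl

end GeneratingPairs

section MainLemma

theorem eq_zero_of_dvd_unimodular {a b i j N : ℕ} {r s : ℤ} (ha : 2 ≤ a) (hb : 2 ≤ b)
    (hrs : r * a + s * b = -1) (hN : a * i + b * j = N) (h : (N : ℤ) ∣ s * i - r * j) : N = 0 := by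
  have hN' : (a * i + b * j : ℤ) = N := by exact_mod_cast hN
  obtain ⟨q, hq⟩ := h
  have hi : (N : ℤ) ∣ i := ⟨-r - b * q, by
    linear_combination (i : ℤ) * hrs + (-r) * hN' - b * hq⟩
  have hj : (N : ℤ) ∣ j := ⟨-s + a * q, by
    linear_combination (j : ℤ) * hrs + (-s) * hN' + a * hq⟩
  rw [Int.natCast_dvd_natCast] at hi hj
  have hi' : i = 0 := by
    by_contra h0
    have := Nat.le_of_dvd (Nat.pos_of_ne_zero h0) hi
    nlinarith [Nat.pos_of_ne_zero h0]
  have hj' : j = 0 := by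
    by_contra h0
    have := Nat.le_of_dvd (Nat.pos_of_ne_zero h0) hj
    nlinarith [Nat.pos_of_ne_zero h0]
  simp [← hN, hi', hj']

open Polynomial IntermediateField WithZero

variable {k W : Type*} [Field k] [Field W] [Algebra k W] [IsAlgClosed W]

/-- The exponents of top weight of a polynomial `P` in two variables lie on a line. -/
theorem exists_sum_eq_of_weight {a b : ℕ} (ha : 2 ≤ a) (hb : 2 ≤ b) (hab : a.Coprime b)
    (S : Finset (Fin 2 →₀ ℕ)) (hS : S.Nonempty) {N : ℕ} (hN : ∀ m ∈ S, a * m 0 + b * m 1 = N)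
    (f : (Fin 2 →₀ ℕ) → k) (hf : ∀ m ∈ S, f m ≠ 0) :
    ∃ (g : k[X]) (l : (Fin 2 →₀ ℕ) → ℕ), g = ∑ m ∈ S, monomial (l m) (f m) ∧
      g.coeff 0 ≠ 0 ∧ 4 * g.natDegree ≤ N ∧
      ∃ m₁ ∈ S, (∃ m₂ ∈ S, l m₂ = g.natDegree) ∧
        ∀ m ∈ S, m 0 + b * l m = m₁ 0 ∧ m 1 = m₁ 1 + a * l m := by
  obtain ⟨m₁, hm₁, hmin⟩ := S.exists_min_image (fun m => m 1) hS
  have hl : ∀ m ∈ S, m 0 + b * ((m 1 - m₁ 1) / a) = m₁ 0 ∧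
      m 1 = m₁ 1 + a * ((m 1 - m₁ 1) / a) := by
    intro m hm
    have h1 := hN m hm
    have h2 := hN m₁ hm₁
    obtain ⟨e, he⟩ := Nat.exists_eq_add_of_le (hmin m hm)
    have h3 : a * m₁ 0 = a * m 0 + b * e := by
      rw [he] at h1
      linarith
    have h4 : a ∣ e := by
      refine hab.dvd_of_dvd_mul_left ?_
      rw [← Nat.dvd_add_right (Dvd.intro (m 0) rfl), ← h3]
      exact Dvd.intro _ rfl
    obtain ⟨q, rfl⟩ := h4
    have ha0 : 0 < a := by omega
    rw [he, Nat.add_sub_cancel_left, Nat.mul_div_cancel_left _ ha0]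
    refine ⟨Nat.eq_of_mul_eq_mul_left ha0 ?_, rfl⟩
    rw [h3]
    ring
  set l : (Fin 2 →₀ ℕ) → ℕ := fun m => (m 1 - m₁ 1) / a
  have hinj : ∀ m ∈ S, ∀ m' ∈ S, l m = l m' → m = m' := by
    intro m hm m' hm' h
    have h1 := hl m hm
    have h2 := hl m' hm'
    simp only [l] at h
    rw [h] at h1
    ext i; fin_cases i
    · exact Nat.add_right_cancel (h1.1.trans h2.1.symm)
    · exact h1.2.trans h2.2.symm
  have hcoeff : ∀ m ∈ S, (∑ m ∈ S, monomial (l m) (f m)).coeff (l m) = f m := by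
    intro m hm
    rw [finsetSum_coeff, Finset.sum_eq_single m, coeff_monomial, if_pos rfl]
    · intro m' hm' hne
      rw [coeff_monomial, if_neg fun h => hne (hinj _ hm' _ hm h)]
    · exact fun h => absurd hm h
  have hl₁ : l m₁ = 0 := by simp [l]
  have h0 := hcoeff m₁ hm₁
  rw [hl₁] at h0
  have hg0 : ∑ m ∈ S, monomial (l m) (f m) ≠ 0 := by
    intro hg
    rw [hg, coeff_zero] at h0
    exact hf m₁ hm₁ h0.symm
  have htop : ∃ m₂ ∈ S, l m₂ = (∑ m ∈ S, monomial (l m) (f m)).natDegree := by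
    by_contra! hne
    refine leadingCoeff_ne_zero.2 hg0 ?_
    rw [leadingCoeff, finsetSum_coeff]
    exact Finset.sum_eq_zero fun m hm => by rw [coeff_monomial, if_neg (hne m hm)]
  refine ⟨_, l, rfl, by rw [h0]; exact hf _ hm₁, ?_, m₁, hm₁, htop, hl⟩
  obtain ⟨m₂, hm₂, h2⟩ := htop
  rw [← h2]
  have h3 := (hl m₂ hm₂).1
  have h4 := hN m₁ hm₁
  calc 4 * l m₂ = 2 * (2 * l m₂) := by ring
    _ ≤ a * (b * l m₂) := by gcongr
    _ ≤ a * m₁ 0 := by gcongr; exact h3 ▸ Nat.le_add_left _ _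
    _ ≤ N := h4 ▸ Nat.le_add_right _ _

/-- If `P(xt, yt) = t` with `deg xt = d a`, `deg yt = d b`, then the terms of top weight of `P`
cancel on the leading terms of `xt` and `yt`. -/
theorem sum_leadingCoeff_eq_zero {a b d : ℕ} {xt yt : k[X]}
    (hx : xt.natDegree = d * a) (hy : yt.natDegree = d * b) {P : MvPolynomial (Fin 2) k}
    (hP : MvPolynomial.aeval ![xt, yt] P = X) {N : ℕ}
    (hN : ∀ m ∈ P.support, a * m 0 + b * m 1 ≤ N) (hd : 0 < d) (hdN : d * N ≠ 1) :
    ∑ m ∈ P.support with a * m 0 + b * m 1 = N,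
      P.coeff m * (xt.leadingCoeff ^ m 0 * yt.leadingCoeff ^ m 1) = 0 := by
  have h := congrArg (fun p => coeff p (d * N)) hP
  simp only [coeff_X, if_neg hdN.symm] at h
  rw [MvPolynomial.aeval_def, MvPolynomial.eval₂_eq', finsetSum_coeff] at h
  rw [Finset.sum_filter]
  refine (Finset.sum_congr rfl fun m hm => ?_).trans h
  have hdeg : (xt ^ m 0 * yt ^ m 1).natDegree ≤ d * (a * m 0 + b * m 1) := by
    refine natDegree_mul_le.trans ?_
    refine (add_le_add natDegree_pow_le natDegree_pow_le).trans ?_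
    rw [hx, hy]
    exact le_of_eq (by ring)
  have h1 : (algebraMap k k[X] (P.coeff m) * ∏ i, ![xt, yt] i ^ m i).coeff (d * N) =
      P.coeff m * (xt ^ m 0 * yt ^ m 1).coeff (d * N) := by
    rw [← C_eq_algebraMap, coeff_C_mul]
    simp
  rw [h1]
  split_ifs with hw
  · congr 1
    rw [← hw]
    have : d * (a * m 0 + b * m 1) = xt.natDegree * m 0 + yt.natDegree * m 1 := by
      rw [hx, hy]; ring
    rw [this]
    rw [← coeff_pow_mul_natDegree xt, ← coeff_pow_mul_natDegree yt, mul_comm _ (m 0),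
      mul_comm _ (m 1)]
    exact (coeff_mul_add_eq_of_natDegree_le natDegree_pow_le natDegree_pow_le).symm
  · have hlt : a * m 0 + b * m 1 < N := lt_of_le_of_ne (hN m hm) hw
    rw [coeff_eq_zero_of_natDegree_lt, mul_zero]
    exact hdeg.trans_lt (Nat.mul_lt_mul_of_pos_left hlt hd)

end MainLemma

section MainLemma

open Polynomial IntermediateField WithZero

variable {k W : Type*} [Field k] [Field W] [Algebra k W]

theorem sameLead_aeval_of_weight {Γ₀ : Type*} [LinearOrderedCommGroupWithZero Γ₀]
    {v : Valuation W Γ₀} {j : RatFunc k →ₐ[k] W} {z : W} (hs : IsSpecialization v j z)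
    {x y : W} {a b : ℕ} {r s : ℤ} (hx : x = z ^ (-a : ℤ) * j RatFunc.X ^ s)
    (hy : y = z ^ (-b : ℤ) * j RatFunc.X ^ (-r)) {P : MvPolynomial (Fin 2) k} {N : ℕ}
    (hN : ∀ m ∈ P.support, a * m 0 + b * m 1 ≤ N) {φ : RatFunc k} (hφ0 : φ ≠ 0)
    (hφ : φ = ∑ m ∈ P.support with a * m 0 + b * m 1 = N,
      RatFunc.C (P.coeff m) * RatFunc.X ^ (s * m 0 - r * m 1 : ℤ)) :
    SameLead v (MvPolynomial.aeval ![x, y] P) (z ^ (-N : ℤ) * j φ) := by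
  have hz := hs.ne_zero
  have hu : j RatFunc.X ≠ 0 := by simpa using RatFunc.X_ne_zero
  have hterm : ∀ m, algebraMap k W (P.coeff m) * ∏ i, ![x, y] i ^ m i =
      z ^ (-(a * m 0 + b * m 1 : ℕ) : ℤ) *
        j (RatFunc.C (P.coeff m) * RatFunc.X ^ (s * m 0 - r * m 1 : ℤ)) := by
    intro m
    have h1 : x ^ m 0 = z ^ (-a * m 0 : ℤ) * j RatFunc.X ^ (s * m 0 : ℤ) := by
      rw [hx, mul_pow, zpow_mul, zpow_mul, zpow_natCast, zpow_natCast]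
    have h2 : y ^ m 1 = z ^ (-b * m 1 : ℤ) * j RatFunc.X ^ (-r * m 1 : ℤ) := by
      rw [hy, mul_pow, zpow_mul, zpow_mul, zpow_natCast, zpow_natCast]
    have h3 : (-(a * m 0 + b * m 1 : ℕ) : ℤ) = -a * m 0 + -b * m 1 := by push_cast; ring
    have h4 : (s * m 0 - r * m 1 : ℤ) = s * m 0 + -r * m 1 := by ring
    rw [Fin.prod_univ_two, map_mul, map_zpow₀, ← RatFunc.algebraMap_eq_C, j.commutes, h3, h4,
      zpow_add₀ hz, zpow_add₀ hu]
    simp only [Matrix.cons_val_zero, Matrix.cons_val_one]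
    rw [h1, h2]
    ring
  have hsum : MvPolynomial.aeval ![x, y] P - z ^ (-N : ℤ) * j φ =
      ∑ m ∈ P.support with ¬ a * m 0 + b * m 1 = N, z ^ (-(a * m 0 + b * m 1 : ℕ) : ℤ) *
        j (RatFunc.C (P.coeff m) * RatFunc.X ^ (s * m 0 - r * m 1 : ℤ)) := by
    rw [MvPolynomial.aeval_def, MvPolynomial.eval₂_eq',
      Finset.sum_congr rfl fun m _ => hterm m,
      ← Finset.sum_filter_add_sum_filter_not _ (fun m => a * m 0 + b * m 1 = N), add_sub_right_comm,
      add_eq_right, sub_eq_zero, hφ, map_sum, Finset.mul_sum]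
    refine Finset.sum_congr rfl fun m hm => ?_
    rw [(Finset.mem_filter.1 hm).2]
  unfold SameLead
  rw [hsum]
  have hv0 : v z ≠ 0 := by simpa using hz
  refine v.map_sum_lt (by simpa [hz] using hφ0) fun m hm => ?_
  rw [Finset.mem_filter] at hm
  have hlt : a * m 0 + b * m 1 < N := lt_of_le_of_ne (hN m hm.1) hm.2
  rw [map_mul v, map_mul v, hs.val_eq_one _ hφ0, hs.val_eq_one, mul_one, mul_one, map_zpow₀,
    map_zpow₀]
  · exact zpow_right_strictAnti₀ (zero_lt_iff.2 hv0) hs.val_lt_one (by omega)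
  · refine mul_ne_zero ?_ (zpow_ne_zero _ RatFunc.X_ne_zero)
    simpa using MvPolynomial.mem_support_iff.1 hm.1

/-- A field generator `P(x, y)` of `k(x, y)` cannot be a coordinate on a curve parametrized by
polynomials whose degrees do not divide each other. -/
theorem false_of_field_generator [IsAlgClosed W] {x y τ : W} (hxy : AlgebraicIndependent k ![x, y])
    {P : MvPolynomial (Fin 2) k}
    (hL : adjoin k {MvPolynomial.aeval ![x, y] P, τ} = adjoin k {x, y}) {a b d : ℕ}
    (ha : 2 ≤ a) (hb : 2 ≤ b) (hab : a.Coprime b) (hd : 0 < d) {xt yt : k[X]}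
    (hx : xt.natDegree = d * a) (hy : yt.natDegree = d * b)
    (hP : MvPolynomial.aeval ![xt, yt] P = X) : False := by
  obtain ⟨r, s, hrs⟩ : ∃ r s : ℤ, r * a + s * b = -1 := by
    have := Nat.gcd_eq_gcd_ab a b
    rw [hab.gcd_eq_one] at this
    exact ⟨-a.gcdA b, -a.gcdB b, by push_cast at this; linear_combination this⟩
  have hx0 : x ≠ 0 := by simpa using hxy.ne_zero 0
  have hy0 : y ≠ 0 := by simpa using hxy.ne_zero 1
  set u := y ^ (a : ℤ) * x ^ (-b : ℤ) with hu
  set z := x ^ r * y ^ s with hz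
  have hu0 : u ≠ 0 := mul_ne_zero (zpow_ne_zero _ hy0) (zpow_ne_zero _ hx0)
  have hz0 : z ≠ 0 := mul_ne_zero (zpow_ne_zero _ hx0) (zpow_ne_zero _ hy0)
  have hmon (p q : ℤ) : z ^ p * u ^ q = x ^ (r * p - b * q) * y ^ (s * p + a * q) := by
    rw [hu, hz, sub_eq_add_neg, ← neg_mul, zpow_add₀ hx0, zpow_add₀ hy0, mul_zpow, mul_zpow,
      zpow_mul, zpow_mul, zpow_mul, zpow_mul]
    ring
  have hxu : x = z ^ (-a : ℤ) * u ^ s := by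
    rw [hmon, show r * -a - b * s = (1 : ℤ) by linear_combination -hrs,
      show s * -a + a * s = (0 : ℤ) by ring]
    simp
  have hyu : y = z ^ (-b : ℤ) * u ^ (-r) := by
    rw [hmon, show r * -b - b * -r = (0 : ℤ) by ring,
      show s * -b + a * -r = (1 : ℤ) by linear_combination -hrs]
    simp
  have hadj : adjoin k {x, y} = adjoin k {u, z} := by
    refine le_antisymm ?_ ?_ <;> rw [adjoin_le_iff, Set.insert_subset_iff, Set.singleton_subset_iff]
    · have h1 : u ∈ adjoin k {u, z} := subset_adjoin _ _ (by simp)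
      have h2 : z ∈ adjoin k {u, z} := subset_adjoin _ _ (by simp)
      constructor
      · rw [hxu]; exact mul_mem (zpow_mem h2 _) (zpow_mem h1 _)
      · rw [hyu]; exact mul_mem (zpow_mem h2 _) (zpow_mem h1 _)
    · have h1 : x ∈ adjoin k {x, y} := subset_adjoin _ _ (by simp)
      have h2 : y ∈ adjoin k {x, y} := subset_adjoin _ _ (by simp)
      exact ⟨mul_mem (zpow_mem h2 _) (zpow_mem h1 _), mul_mem (zpow_mem h1 _) (zpow_mem h2 _)⟩
  obtain ⟨V, j, hj, hs⟩ := exists_isSpecialization (hxy.pair_of_adjoin_le hadj.le)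
  -- the terms of top weight
  have hP0 : P.support.Nonempty := by
    rw [Finset.nonempty_iff_ne_empty, Ne, MvPolynomial.support_eq_empty]
    rintro rfl
    exact X_ne_zero (R := k) (by simpa using hP.symm)
  obtain ⟨m₀, hm₀, hmax⟩ := P.support.exists_max_image (fun m => a * m 0 + b * m 1) hP0
  set N := a * m₀ 0 + b * m₀ 1 with hN
  have hN0 : N ≠ 0 := by
    intro h0
    have hzero : P.totalDegree = 0 := by
      rw [MvPolynomial.totalDegree_eq_zero_iff]
      intro m hm
      have := hmax m hm
      have h1 : a * m 0 + b * m 1 = 0 := by omega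
      simp only [Nat.add_eq_zero_iff, mul_eq_zero] at h1
      rw [Fin.forall_fin_two]
      omega
    rw [MvPolynomial.totalDegree_eq_zero_iff_eq_C.1 hzero, MvPolynomial.aeval_C,
      ← C_eq_algebraMap] at hP
    simpa using congrArg natDegree hP
  have hN2 : 2 ≤ N := by
    by_contra h1
    have h2 : m₀ 0 = 0 := by by_contra h0; nlinarith [Nat.pos_of_ne_zero h0]
    have h3 : m₀ 1 = 0 := by by_contra h0; nlinarith [Nat.pos_of_ne_zero h0]
    exact hN0 (by rw [hN, h2, h3, mul_zero, mul_zero, add_zero])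
  set S := P.support.filter fun m => a * m 0 + b * m 1 = N
  have hSN : ∀ m ∈ S, a * m 0 + b * m 1 = N := fun m hm => (Finset.mem_filter.1 hm).2
  obtain ⟨g, l, hg, hg0, hgN, m₁, hm₁, ⟨m₂, hm₂, hl₂⟩, hl⟩ := exists_sum_eq_of_weight ha hb hab S
    ⟨m₀, Finset.mem_filter.2 ⟨hm₀, rfl⟩⟩ hSN P.coeff
    fun m hm => MvPolynomial.mem_support_iff.1 (Finset.mem_filter.1 hm).1
  have hgne : g ≠ 0 := by rintro rfl; simp at hg0
  have hexp : ∀ m ∈ S, (s * m 0 - r * m 1 : ℤ) = s * m₁ 0 - r * m₁ 1 + l m := by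
    intro m hm
    obtain ⟨h1, h2⟩ := hl m hm
    zify at h1 h2
    linear_combination s * h1 - r * h2 - l m * hrs
  set e := (s * m₁ 0 - r * m₁ 1 : ℤ)
  let φ : RatFunc k := RatFunc.X ^ e * algebraMap k[X] _ g
  have hφ0 : φ ≠ 0 := mul_ne_zero (zpow_ne_zero _ RatFunc.X_ne_zero) (by simpa using hgne)
  have hφ : φ = ∑ m ∈ S, RatFunc.C (P.coeff m) * RatFunc.X ^ (s * m 0 - r * m 1 : ℤ) := by
    simp only [φ, hg, map_sum, Finset.mul_sum]
    refine Finset.sum_congr rfl fun m hm => ?_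
    rw [hexp m hm, zpow_add₀ RatFunc.X_ne_zero, zpow_natCast, ← C_mul_X_pow_eq_monomial, map_mul,
      map_pow, RatFunc.algebraMap_X, RatFunc.algebraMap_C]
    ring
  obtain ⟨t, ht0, httop, ht⟩ := exists_residue_generator hs (by rw [hL, hadj, hj])
    (Nat.pos_of_ne_zero hN0) (sameLead_aeval_of_weight hs (by rwa [hj]) (by rwa [hj]) hmax hφ0 hφ)
  -- `g` vanishes at a nonzero point
  have hξ : xt.leadingCoeff ≠ 0 := by
    rw [Ne, leadingCoeff_eq_zero]
    rintro rfl
    rw [natDegree_zero, eq_comm, mul_eq_zero] at hx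
    omega
  have hη : yt.leadingCoeff ≠ 0 := by
    rw [Ne, leadingCoeff_eq_zero]
    rintro rfl
    rw [natDegree_zero, eq_comm, mul_eq_zero] at hy
    omega
  set ξ := xt.leadingCoeff
  set η := yt.leadingCoeff
  let c : k := η ^ a / ξ ^ b
  have hc : c ≠ 0 := div_ne_zero (pow_ne_zero _ hη) (pow_ne_zero _ hξ)
  have hgc : g.IsRoot c := by
    have h := sum_leadingCoeff_eq_zero hx hy hP hmax hd (by nlinarith)
    have h1 : ξ ^ m₁ 0 * η ^ m₁ 1 * g.eval c = 0 := by
      rw [← h, hg, eval_finsetSum, Finset.mul_sum]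
      refine Finset.sum_congr rfl fun m hm => ?_
      obtain ⟨h1, h2⟩ := hl m hm
      rw [eval_monomial, ← h1, h2, div_pow, pow_add, pow_add, ← pow_mul, ← pow_mul]
      simp only [ξ, η] at hξ hη ⊢
      field_simp
    exact (mul_eq_zero.1 h1).resolve_left
      (mul_ne_zero (pow_ne_zero _ hξ) (pow_ne_zero _ hη))
  have hgroot := (rootMultiplicity_pos hgne).2 hgc
  have hgroot' : g.rootMultiplicity c ≤ g.natDegree := by
    classical
    rw [← count_roots]
    exact (Multiset.count_le_card _ _).trans (card_roots' g)
  obtain ⟨v₀, h₀, h₀'⟩ := exists_valuation_at (0 : k)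
  obtain ⟨v₁, h₁, h₁'⟩ := exists_valuation_at c
  obtain ⟨v₂, h₂, h₂'⟩ := exists_valuation_infty (k := k)
  have hlog (w : Valuation (RatFunc k) ℤᵐ⁰) : log (w φ) =
      e * log (w (algebraMap k[X] _ X)) + log (w (algebraMap k[X] _ g)) := by
    rw [map_mul, map_zpow₀, log_mul, log_zpow, RatFunc.algebraMap_X, smul_eq_mul]
    · exact zpow_ne_zero _ (by simpa using RatFunc.X_ne_zero)
    · simpa using hgne
  have hdvd : ∀ m ∈ S, ¬ (N : ℤ) ∣ s * m 0 - r * m 1 := fun m hm h =>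
    hN0 (eq_zero_of_dvd_unimodular ha hb hrs (hSN m hm) h)
  refine false_of_three_places ht0 httop hc h₀ h₀' h₁ h₁' h₂ h₂' (ht v₀ h₀ ?_) (ht v₁ h₁ ?_)
    (ht v₂ h₂ ?_)
  · rw [hlog, h₀' _ X_ne_zero, h₀' _ hgne, rootMultiplicity_eq_zero (p := g)]
    · have := rootMultiplicity_X_sub_C_self (x := (0 : k))
      rw [C_0, sub_zero] at this
      simpa [this] using hdvd m₁ hm₁
    · rwa [IsRoot, ← coeff_zero_eq_eval_zero]
  · rw [hlog, h₁' _ X_ne_zero, h₁' _ hgne, rootMultiplicity_eq_zero (p := X) (by simpa using hc)]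
    simp only [log_exp, Nat.cast_zero, neg_zero, mul_zero, zero_add, dvd_neg,
      Int.natCast_dvd_natCast]
    intro hle
    have := Nat.le_of_dvd hgroot hle
    omega
  · rw [hlog, h₂' _ X_ne_zero, h₂' _ hgne]
    have := hdvd m₂ hm₂
    rw [hexp m₂ hm₂, hl₂] at this
    simpa using this

end MainLemma

section IntegralMultiple

open Polynomial IntermediateField

variable {k M Γ₀ : Type*} [Field k] [Field M] [Algebra k M]
  [LinearOrderedCommGroupWithZero Γ₀] {v : Valuation M Γ₀}

theorem exists_eval₂_of_mem_adjoin_pair {F τ x : M} (hx : x ∈ Algebra.adjoin k {F, τ}) :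
    ∃ P : k[X][X], eval₂ (aeval F : k[X] →ₐ[k] M).toRingHom τ P = x := by
  induction hx using Algebra.adjoin_induction with
  | mem x hx =>
    rcases hx with rfl | rfl
    · exact ⟨C X, by simp⟩
    · exact ⟨X, by simp⟩
  | algebraMap c => exact ⟨C (C c), by simp⟩
  | add x y _ _ hx hy =>
    obtain ⟨P, rfl⟩ := hx
    obtain ⟨Q, rfl⟩ := hy
    exact ⟨P + Q, by rw [eval₂_add]⟩
  | mul x y _ _ hx hy =>
    obtain ⟨P, rfl⟩ := hx
    obtain ⟨Q, rfl⟩ := hy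
    exact ⟨P * Q, by rw [eval₂_mul]⟩

theorem val_eval₂_eq_pow {A : Type*} [CommRing A] {φ : A →+* M} (hφ : ∀ a, a ≠ 0 → v (φ a) = 1)
    {τ : M} (hτ : 1 < v τ) (n : ℕ) (P : A[X]) (hP : P ≠ 0) (hn : P.natDegree = n) :
    v (eval₂ φ τ P) = v τ ^ n := by
  induction n generalizing P with
  | zero =>
    rw [eq_C_of_natDegree_eq_zero hn] at hP ⊢
    rw [eval₂_C, pow_zero]
    exact hφ _ (by rintro h; simp [h] at hP)
  | succ n ih =>
    have hd : P.divX.natDegree = n := by rw [natDegree_divX_eq_natDegree_tsub_one]; omega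
    have hd0 : P.divX ≠ 0 := by
      intro h
      rw [divX_eq_zero_iff] at h
      rw [h] at hn
      simp at hn
    rw [← divX_mul_X_add P, eval₂_add, eval₂_mul, eval₂_X, eval₂_C]
    have h1 : v (eval₂ φ τ P.divX * τ) = v τ ^ (n + 1) := by
      rw [map_mul, ih _ hd0 hd, pow_succ]
    rw [← h1]
    refine v.map_add_eq_of_lt_left ?_
    rw [h1]
    refine lt_of_le_of_lt ?_ (one_lt_pow₀ hτ n.succ_ne_zero)
    by_cases h0 : P.coeff 0 = 0
    · simp [h0]
    · exact (hφ _ h0).le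

theorem exists_aeval_mul_mem {R : Subalgebra k M} (hR : ∀ x : M, IsIntegral R x → x ∈ R)
    {F τ b : M} (hF : F ∈ R) (hv : ∀ f : k[X], f ≠ 0 → v (aeval F f) = 1) (hτ : 1 < v τ)
    (hb : b ∈ R) (hvb : 1 < v b) (htop : adjoin k {F, τ} = ⊤) :
    ∃ p : k[X], p ≠ 0 ∧ aeval F p * τ ∈ R := by
  have hbt : b ∈ adjoin k {F, τ} := by rw [htop]; trivial
  obtain ⟨r, hr, s, hs, hbrs⟩ := mem_adjoin_iff_div.1 hbt
  obtain ⟨P, rfl⟩ := exists_eval₂_of_mem_adjoin_pair hr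
  obtain ⟨Q, rfl⟩ := exists_eval₂_of_mem_adjoin_pair hs
  have hb0 : b ≠ 0 := by rintro rfl; simp at hvb
  have hP0 : P ≠ 0 := by rintro rfl; simp [hb0] at hbrs
  have hQ0 : Q ≠ 0 := by rintro rfl; simp [hb0] at hbrs
  have hvP := val_eval₂_eq_pow (φ := (aeval F : k[X] →ₐ[k] M).toRingHom) hv hτ _ P hP0 rfl
  have hvQ := val_eval₂_eq_pow (φ := (aeval F : k[X] →ₐ[k] M).toRingHom) hv hτ _ Q hQ0 rfl
  have hτ0 : 0 < v τ := zero_lt_one.trans hτ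
  have hQP : Q.natDegree < P.natDegree := by
    rw [hbrs, map_div₀, hvP, hvQ, one_lt_div₀ (pow_pos hτ0 _)] at hvb
    exact (pow_lt_pow_iff_right₀ hτ).1 hvb
  let φ : k[X] →ₐ[k] R := aeval ⟨F, hF⟩
  have hφ (f : k[X]) : (φ f : M) = aeval F f := by
    change R.val (aeval _ f) = _
    rw [← aeval_algHom_apply]
    rfl
  have hφinj : Function.Injective φ.toRingHom := by
    rw [injective_iff_map_eq_zero]
    intro f hf
    by_contra h0
    have h1 := hv f h0
    rw [← hφ f, show φ f = 0 from hf] at h1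
    simp at h1
  have heval (S : k[X][X]) : aeval τ (S.map φ.toRingHom) =
      eval₂ (aeval F : k[X] →ₐ[k] M).toRingHom τ S := by
    rw [aeval_def, eval₂_map]
    congr 1
    ext f
    · exact hφ _
    · exact hφ _
  have hQM : eval₂ (aeval F : k[X] →ₐ[k] M).toRingHom τ Q ≠ 0 := by
    intro h; rw [h] at hvQ
    rw [map_zero] at hvQ
    exact pow_ne_zero _ hτ0.ne' hvQ.symm
  let H : Polynomial R := P.map φ.toRingHom - C ⟨b, hb⟩ * Q.map φ.toRingHom
  have hdeg : ((C ⟨b, hb⟩ : Polynomial R) * Q.map φ.toRingHom).degree <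
      (P.map φ.toRingHom).degree := by
    rw [degree_map_eq_of_injective hφinj]
    refine lt_of_le_of_lt ((degree_mul_le _ _).trans (add_le_add_left degree_C_le _)) ?_
    rw [zero_add, degree_map_eq_of_injective hφinj]
    exact degree_lt_degree hQP
  have hlc : H.leadingCoeff = φ P.leadingCoeff := by
    rw [leadingCoeff_sub_of_degree_lt hdeg, leadingCoeff_map_of_injective hφinj]
    rfl
  have hH : aeval τ H = 0 := by
    simp only [H, map_sub, map_mul, heval, aeval_C]
    change _ - b * _ = 0
    rw [hbrs]
    field_simp
    simp
  refine ⟨P.leadingCoeff, by simpa using hP0, ?_⟩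
  have := hR _ (isIntegral_leadingCoeff_smul H τ hH)
  rw [hlc, Algebra.smul_def] at this
  rwa [← hφ]

end IntegralMultiple

section ResidueRing

open Polynomial IntermediateField

variable {k W Γ₀ : Type*} [Field k] [Field W] [Algebra k W]
  [LinearOrderedCommGroupWithZero Γ₀] {v : Valuation W Γ₀}
  {j : RatFunc k →ₐ[k] W} {z U T : W}

theorem exists_aeval_of_mem_adjoin_pair {x : W} (hx : x ∈ Algebra.adjoin k {U, T}) :
    ∃ f : Polynomial k⟮T⟯, aeval U f = x := by
  have : Algebra.adjoin k {U, T} ≤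
      ((aeval U : Polynomial k⟮T⟯ →ₐ[k⟮T⟯] W).range).restrictScalars k := by
    rw [Algebra.adjoin_le_iff]
    rintro y (rfl | rfl)
    · exact ⟨X, by simp⟩
    · exact ⟨C (AdjoinSimple.gen k y), by simp⟩
  exact this hx

theorem exists_one_lt_of_mem_adjoin_pair (hk : ∀ c : k, v (algebraMap k W c) ≤ 1) {x : W}
    (hx : x ∈ Algebra.adjoin k {U, T}) (hvx : 1 < v x) : 1 < v U ∨ 1 < v T := by
  by_contra! h
  refine hvx.not_ge ?_
  induction hx using Algebra.adjoin_induction with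
  | mem x hx =>
    rcases hx with rfl | rfl
    · exact h.1
    · exact h.2
  | algebraMap c => exact hk c
  | add x y _ _ hx hy =>
    by_contra! hlt
    rcases lt_max_iff.1 (hlt.trans_le (v.map_add x y)) with h' | h'
    · exact (hx h').not_gt h'
    · exact (hy h').not_gt h'
  | mul x y _ _ hx hy =>
    by_contra! hlt
    have hx' : v x ≤ 1 := by
      by_contra! h'
      exact (hx h').not_gt h'
    have hy' : v y ≤ 1 := by
      by_contra! h'
      exact (hy h').not_gt h'
    rw [map_mul] at hlt
    exact hlt.not_ge (mul_le_one₀ hx' zero_le hy')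

theorem eq_C_of_mul_aeval_sub_one_lt [IsAlgClosed W] (hs : IsSpecialization v j z) (hT : 1 < v T)
    (hF : j RatFunc.X ∈ Algebra.adjoin k {U, T}) {b : W} (hb : b ∈ Algebra.adjoin k {U, T})
    {M : k[X]} (hbM : v (b * aeval (j RatFunc.X) M - 1) < 1) : ∃ c, M = C c := by
  have hM0 : M ≠ 0 := by
    rintro rfl
    simp at hbM
  have hu : j RatFunc.X ∈ k⟮T⟯⟮U⟯ := by
    obtain ⟨f, hf⟩ := exists_aeval_of_mem_adjoin_pair hF
    rw [← hf]
    exact algebra_adjoin_le_adjoin _ _ (aeval_mem_adjoin_singleton _ _)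
  obtain ⟨-, α, hα⟩ := exists_keyPolynomial_of_isSpecialization hs hT hu
  have hMF : aeval (j RatFunc.X) M ∈ Algebra.adjoin k {U, T} :=
    (Algebra.adjoin_le (Set.singleton_subset_iff.2 hF)) (aeval_mem_adjoin_singleton _ _)
  obtain ⟨f₁, hf₁⟩ := exists_aeval_of_mem_adjoin_pair hMF
  obtain ⟨f₂, hf₂⟩ := exists_aeval_of_mem_adjoin_pair hb
  have hs1 : SameLead v (aeval U (f₁ * f₂)) 1 := by
    rw [map_mul, hf₁, hf₂, mul_comm, SameLead, map_one]
    exact hbM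
  have hf0 : f₁ * f₂ ≠ 0 := by
    intro h
    rw [h, map_zero] at hs1
    exact hs1.ne_zero_left rfl
  have hf10 : f₁ ≠ 0 := left_ne_zero_of_mul hf0
  have hlead : SameLead v (aeval U f₁) (aeval α f₁) := by
    refine sameLead_aeval hf10 fun β hβ => ?_
    rw [mem_aroots] at hβ
    by_contra! hle
    exact hα.not_sameLead (f := f₁ * f₂) (by rw [map_mul, hβ.2, zero_mul]) hf0 hle
      isAlgebraic_one hs1
  have halg : IsAlgebraic k⟮T⟯ (aeval α f₁) :=
    isAlgebraic_iff_isIntegral.2 (.of_mem_of_fg _ hα.1.isIntegral.fg_adjoin_singleton _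
      (aeval_mem_adjoin_singleton _ _))
  obtain ⟨c, hc⟩ := IsAlgLead.exists_eq_C (ψ := algebraMap k[X] (RatFunc k) M) hs hT
    ⟨_, halg, by rwa [zpow_zero, one_mul, ratFunc_algHom_algebraMap, ← hf₁]⟩
  rw [← RatFunc.algebraMap_C] at hc
  exact ⟨c, RatFunc.algebraMap_injective k hc⟩

/-- If a subalgebra `R` containing `F` of a polynomial ring `k[U, T]` is integral at a
specialization over `k(F)` of which `T` is a pole, then all its residues are polynomials in `F`. -/
theorem exists_val_sub_aeval_lt_one [IsAlgClosed W] (hs : IsSpecialization v j z) (hT : 1 < v T)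
    {R : Subalgebra k W} (hR : R ≤ Algebra.adjoin k {U, T}) (hF : j RatFunc.X ∈ R)
    (hInt : ∀ a ∈ R, v a ≤ 1) (hgen : ∀ a ∈ R, a ∈ adjoin k {j RatFunc.X, z}) {a : W}
    (ha : a ∈ R) : ∃ f : k[X], v (a - aeval (j RatFunc.X) f) < 1 := by
  rcases (hInt a ha).lt_or_eq with hlt | heq
  · exact ⟨0, by simpa using hlt⟩
  have ha0 : a ≠ 0 := by rintro rfl; simp at heq
  obtain ⟨n, φ, hφ, hsl⟩ := hs.exists_sameLead (hgen a ha) ha0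
  have hn : n = 0 := by
    refine hs.val_zpow_eq ?_
    have := hsl.val_eq
    rwa [heq, map_mul, hs.val_eq_one _ hφ, mul_one, map_zpow₀, eq_comm] at this
  rw [hn, zpow_zero, one_mul] at hsl
  have hsl' : v (a - j φ) < 1 := by rwa [SameLead, hs.val_eq_one _ hφ] at hsl
  have hjφ : j φ * aeval (j RatFunc.X) φ.denom = aeval (j RatFunc.X) φ.num := by
    rw [← ratFunc_algHom_algebraMap, ← ratFunc_algHom_algebraMap, ← map_mul]
    congr 1
    nth_rw 1 [← RatFunc.num_div_denom φ]
    exact div_mul_cancel₀ _ (by simpa using φ.denom_ne_zero)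
  obtain ⟨s, t, hst⟩ := φ.isCoprime_num_denom
  have hpF (f : k[X]) : aeval (j RatFunc.X) f ∈ R :=
    (Algebra.adjoin_le (Set.singleton_subset_iff.2 hF)) (aeval_mem_adjoin_singleton _ _)
  have hb : aeval (j RatFunc.X) s * a + aeval (j RatFunc.X) t ∈ R :=
    add_mem (mul_mem (hpF s) ha) (hpF t)
  obtain ⟨c, hc⟩ := eq_C_of_mul_aeval_sub_one_lt hs hT (hR hF) (hR hb) (M := φ.denom) (by
    have hst' := congrArg (aeval (j RatFunc.X)) hst
    simp only [map_add, map_mul, map_one] at hst'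
    have : (aeval (j RatFunc.X) s * a + aeval (j RatFunc.X) t) * aeval (j RatFunc.X) φ.denom - 1
        = aeval (j RatFunc.X) s * aeval (j RatFunc.X) φ.denom * (a - j φ) := by
      linear_combination hst' + aeval (j RatFunc.X) s * hjφ
    rw [this, map_mul]
    exact mul_lt_one_of_nonneg_of_lt_one_right (hInt _ (mul_mem (hpF _) (hpF _))) zero_le hsl')
  have hc1 : φ.denom = 1 := by
    have := φ.monic_denom
    rw [hc] at this ⊢
    have : c = 1 := by simpa [Monic] using this
    simp [this]
  rw [hc1, map_one, mul_one] at hjφ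
  exact ⟨φ.num, by rwa [← hjφ]⟩

end ResidueRing

section PrimeOfGenerator

open Polynomial IntermediateField

variable {k L : Type*} [Field k] [Field L] [Algebra k L]

theorem adjoin_aeval_mul_eq_top {F g : L} {p : k[X]} (hp : aeval F p ≠ 0)
    (h : adjoin k {F, g} = ⊤) : adjoin k {F, aeval F p * g} = ⊤ := by
  rw [eq_top_iff, ← h, adjoin_le_iff]
  have hF : F ∈ adjoin k {F, aeval F p * g} := subset_adjoin _ _ (by simp)
  rintro y (rfl | rfl)
  · exact hF
  · have h1 : aeval F p * y ∈ adjoin k {F, aeval F p * y} := subset_adjoin _ _ (by simp)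
    have h2 : aeval F p ∈ adjoin k {F, aeval F p * y} :=
      (Algebra.adjoin_le (S := (adjoin k {F, aeval F p * y}).toSubalgebra)
        (Set.singleton_subset_iff.2 hF)) (aeval_mem_adjoin_singleton _ _)
    have := div_mem h1 h2
    rwa [mul_div_cancel_left₀ _ hp] at this

theorem exists_valuation_of_generator {W : Type*} [Field W] [IsAlgClosed W] [Algebra k W]
    (ι : L →ₐ[k] W) {R : Subalgebra k L}
    (hR : ∀ x : L, IsIntegral R x → x ∈ R) {F G x y U T : L} (hxy : AlgebraicIndependent k ![x, y])
    (hF : F ∈ R) (hRB : R ≤ Algebra.adjoin k {U, T}) (hG : G ∈ Algebra.adjoin k {U, T})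
    (htop : adjoin k {F, G} = ⊤) (hbad : ∀ g ∈ R, adjoin k {F, g} ≠ ⊤) :
    ∃ (V : ValuationSubring W) (w : Valuation L V.ValueGroup),
      (∀ a ∈ R, w a ≤ 1) ∧ (∀ f : k[X], f ≠ 0 → w (aeval F f) = 1) ∧
        ∀ a ∈ R, ∃ f : k[X], w (a - aeval F f) < 1 := by
  have hFG : AlgebraicIndependent k ![ι F, ι G] := by
    convert (hxy.pair_of_adjoin_eq_top htop).map' (f := ι) ι.injective using 1
    ext i; fin_cases i <;> rfl
  have hle : adjoin k {ι F, ι G} ≤ adjoin k {ι F, (ι G)⁻¹} := by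
    rw [adjoin_le_iff]
    rintro y (rfl | rfl)
    · exact subset_adjoin _ _ (by simp)
    · have : (ι G)⁻¹ ∈ adjoin k {ι F, (ι G)⁻¹} := subset_adjoin _ _ (by simp)
      have h2 := inv_mem this
      rwa [inv_inv] at h2
  obtain ⟨V, j, hj, hs⟩ := exists_isSpecialization (hFG.pair_of_adjoin_le hle)
  let w := V.valuation.comap ι.toRingHom
  have hw (a : L) : w a = V.valuation (ι a) := rfl
  have hwF (f : k[X]) (hf : f ≠ 0) : w (aeval F f) = 1 := by
    rw [hw, ← aeval_algHom_apply, ← hj]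
    exact hs.val_aeval hf
  have hwG : 1 < w G := by
    have := hs.val_lt_one
    have h0 := hs.ne_zero
    rw [map_inv₀] at this
    have hG0 : 0 < V.valuation (ι G) := by
      rw [zero_lt_iff, Valuation.ne_zero_iff]
      simpa using h0
    exact (inv_lt_one₀ hG0).1 this
  have hInt : ∀ a ∈ R, w a ≤ 1 := by
    intro a ha
    by_contra! hlt
    obtain ⟨p, hp, hpG⟩ := exists_aeval_mul_mem hR hF hwF hwG ha hlt htop
    refine hbad _ hpG (adjoin_aeval_mul_eq_top ?_ htop)
    intro h0
    simpa [h0] using hwF p hp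
  refine ⟨V, w, hInt, hwF, ?_⟩
  have hGT : ∃ U' T', Algebra.adjoin k {U, T} = Algebra.adjoin k {U', T'} ∧ 1 < w T' := by
    rcases exists_one_lt_of_mem_adjoin_pair (v := w) (fun c => by
      rw [hw, ι.commutes]
      exact hs.val_algebraMap c) hG hwG with h | h
    · exact ⟨T, U, by rw [Set.pair_comm], h⟩
    · exact ⟨U, T, rfl, h⟩
  obtain ⟨U', T', hUT, hT'⟩ := hGT
  rw [hUT] at hRB
  intro a ha
  obtain ⟨f, hf⟩ := exists_val_sub_aeval_lt_one (U := ι U') (T := ι T') hs hT' (R := R.map ι)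
    (by
      have := Subalgebra.map_mono (f := ι) hRB
      rwa [AlgHom.map_adjoin, Set.image_pair] at this)
    (by rw [hj]; exact ⟨F, hF, rfl⟩)
    (by rintro _ ⟨b, hb, rfl⟩; exact hInt b hb)
    (by
      rintro _ ⟨b, hb, rfl⟩
      rw [hj]
      refine hle ?_
      have : b ∈ adjoin k {F, G} := by rw [htop]; trivial
      have := (IntermediateField.mem_map _ (f := ι)).2 ⟨b, this, rfl⟩
      rwa [adjoin_map, Set.image_pair] at this)
    ⟨a, ha, rfl⟩
  refine ⟨f, ?_⟩
  rw [hw, map_sub, ← aeval_algHom_apply, ← hj]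
  exact hf

theorem exists_isPrime_bijective_of_valuation {A Γ₀ : Type*} [CommRing A] [Algebra k A]
    [Algebra A L] [IsScalarTower k A L] [LinearOrderedCommGroupWithZero Γ₀] (w : Valuation L Γ₀)
    {F : A} (hInt : ∀ a : A, w (algebraMap A L a) ≤ 1)
    (hF : ∀ f : k[X], f ≠ 0 → w (aeval (algebraMap A L F) f) = 1)
    (hres : ∀ a : A, ∃ f : k[X], w (algebraMap A L a - aeval (algebraMap A L F) f) < 1) :
    ∃ p : Ideal A, p.IsPrime ∧
      Function.Bijective (fun q : k[X] => Ideal.Quotient.mk p (aeval F q)) := by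
  let p : Ideal A :=
    { carrier := {a | w (algebraMap A L a) < 1}
      add_mem' := fun {a b} ha hb => by
        simpa using w.map_add_lt ha hb
      zero_mem' := by simp
      smul_mem' := fun c a ha => by
        change w (algebraMap A L (c * a)) < 1
        rw [map_mul, map_mul]
        exact mul_lt_one_of_nonneg_of_lt_one_right (hInt c) zero_le ha }
  have hp (a : A) : a ∈ p ↔ w (algebraMap A L a) < 1 := Iff.rfl
  refine ⟨p, ⟨?_, ?_⟩, ?_, ?_⟩
  · rw [Ideal.ne_top_iff_one, hp]
    simp
  · intro a b hab
    by_contra! h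
    rw [hp, hp, not_lt, not_lt] at h
    rw [hp, map_mul, map_mul, (hInt a).antisymm h.1, (hInt b).antisymm h.2] at hab
    simp at hab
  · intro f g hfg
    have hfg' : aeval F f - aeval F g ∈ p := Ideal.Quotient.eq.1 hfg
    rw [← map_sub, hp, ← aeval_algebraMap_apply] at hfg'
    by_contra hne
    exact hfg'.ne (hF _ (sub_ne_zero.2 hne))
  · intro x
    obtain ⟨a, rfl⟩ := Ideal.Quotient.mk_surjective x
    obtain ⟨f, hf⟩ := hres a
    refine ⟨f, ?_⟩
    refine (Ideal.Quotient.eq.2 ?_).symm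
    rwa [hp, map_sub, ← aeval_algebraMap_apply]

end PrimeOfGenerator

section Coordinates

open Polynomial IntermediateField

variable {k A L : Type*} [Field k] [CommRing A] [Algebra k A]

theorem adjoin_pair_eq_top_of_mem {P Q P' Q' : A} (h : Algebra.adjoin k {P, Q} = ⊤)
    (hP : P ∈ Algebra.adjoin k {P', Q'}) (hQ : Q ∈ Algebra.adjoin k {P', Q'}) :
    Algebra.adjoin k {P', Q'} = ⊤ := by
  rw [eq_top_iff, ← h, Algebra.adjoin_le_iff]
  rintro y (rfl | rfl)
  exacts [hP, hQ]

theorem adjoin_pair_sub_eq_top {P Q R : A} (h : Algebra.adjoin k {P, Q} = ⊤)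
    (hR : R ∈ Algebra.adjoin k {P}) : Algebra.adjoin k {P, Q - R} = ⊤ := by
  have hR' : R ∈ Algebra.adjoin k {P, Q - R} := Algebra.adjoin_mono (by simp) hR
  refine adjoin_pair_eq_top_of_mem h (Algebra.subset_adjoin (by simp)) ?_
  have : Q - R ∈ Algebra.adjoin k {P, Q - R} := Algebra.subset_adjoin (by simp)
  simpa using add_mem this hR'

theorem mvPolynomial_aeval_pair_map {S : Type*} [CommRing S] [Algebra k S] (θ : A →ₐ[k] S) (P Q : A)
    (f : MvPolynomial (Fin 2) k) :
    MvPolynomial.aeval ![θ P, θ Q] f = θ (MvPolynomial.aeval ![P, Q] f) := by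
  rw [MvPolynomial.comp_aeval_apply]
  congr 2
  ext i; fin_cases i <;> rfl

theorem exists_natDegree_sub_lt {p q : k[X]} (hq : 0 < q.natDegree)
    (h : p.natDegree ∣ q.natDegree) :
    ∃ (c : k) (s : ℕ), (q - C c * p ^ s).natDegree < q.natDegree := by
  obtain ⟨s, hs⟩ := h
  have hp : 0 < p.natDegree := Nat.pos_of_ne_zero fun h0 => by simp [h0] at hs; omega
  have hq0 : q ≠ 0 := by rintro rfl; simp at hq
  have hp0 : p ≠ 0 := by rintro rfl; simp at hp
  have hc : q.leadingCoeff / p.leadingCoeff ^ s ≠ 0 :=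
    div_ne_zero (by simpa using hq0) (pow_ne_zero _ (by simpa using hp0))
  refine ⟨q.leadingCoeff / p.leadingCoeff ^ s, s, ?_⟩
  by_cases h0 : q - C (q.leadingCoeff / p.leadingCoeff ^ s) * p ^ s = 0
  · rw [h0]
    simpa using hq
  refine natDegree_lt_natDegree h0 (degree_sub_lt_left ?_ hq0 ?_)
  · rw [degree_C_mul hc, degree_eq_natDegree hq0, degree_eq_natDegree (pow_ne_zero s hp0),
      natDegree_pow, hs, mul_comm]
  · rw [leadingCoeff_mul, leadingCoeff_C, leadingCoeff_pow,
      div_mul_cancel₀ _ (pow_ne_zero _ (by simpa using hp0))]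

variable [Field L] [Algebra k L] [Algebra A L] [IsFractionRing A L] [IsScalarTower k A L]

theorem intermediateField_adjoin_pair_eq_top {P Q : A} (h : Algebra.adjoin k {P, Q} = ⊤) :
    adjoin k {algebraMap A L P, algebraMap A L Q} = ⊤ := by
  have hA (a : A) : algebraMap A L a ∈ adjoin k {algebraMap A L P, algebraMap A L Q} := by
    have ha : a ∈ Algebra.adjoin k {P, Q} := by rw [h]; trivial
    have := (Subalgebra.mem_map (f := IsScalarTower.toAlgHom k A L)).2 ⟨a, ha, rfl⟩
    rw [AlgHom.map_adjoin, Set.image_pair] at this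
    exact algebra_adjoin_le_adjoin _ _ this
  rw [eq_top_iff]
  intro x _
  obtain ⟨a, b, -, rfl⟩ := IsFractionRing.div_surjective (A := A) x
  exact div_mem (hA a) (hA b)

theorem exists_mvPolynomial_aeval_of_adjoin_pair_eq_top {P Q : A}
    (h : Algebra.adjoin k {P, Q} = ⊤) (a : A) :
    ∃ f : MvPolynomial (Fin 2) k, MvPolynomial.aeval ![P, Q] f = a := by
  have ha : a ∈ Algebra.adjoin k (Set.range ![P, Q]) := by
    rw [Matrix.range_cons_cons_empty, h]; trivial
  rwa [Algebra.adjoin_range_eq_range_aeval] at ha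

theorem exists_generators_map_eq_zero {ε : A →ₐ[k] k[X]} {F : A} (hε : ε F = X) {g : L}
    (hg : adjoin k {algebraMap A L F, g} = ⊤) {c d : L} (hcd : AlgebraicIndependent k ![c, d])
    (n : ℕ) (P Q : A) (hPQ : Algebra.adjoin k {P, Q} = ⊤)
    (hn : (ε P).natDegree + (ε Q).natDegree = n) :
    ∃ P' Q' : A, Algebra.adjoin k {P', Q'} = ⊤ ∧ ε P' = 0 := by
  induction n using Nat.strong_induction_on generalizing P Q with
  | _ n ih =>
  wlog hle : (ε P).natDegree ≤ (ε Q).natDegree generalizing P Q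
  · exact this Q P (by rwa [Set.pair_comm]) (by omega) (by omega)
  rcases Nat.eq_zero_or_pos (ε P).natDegree with h0 | hpos
  · refine ⟨P - algebraMap k A ((ε P).coeff 0), Q, ?_, ?_⟩
    · rw [Set.pair_comm]
      refine adjoin_pair_sub_eq_top (by rwa [Set.pair_comm]) (Subalgebra.algebraMap_mem _ _)
    · rw [map_sub, AlgHom.commutes, eq_C_of_natDegree_eq_zero h0]
      simp
  have hpos' := hpos.trans_le hle
  by_cases hdvd : (ε P).natDegree ∣ (ε Q).natDegree
  · obtain ⟨e, s, hlt⟩ := exists_natDegree_sub_lt hpos' hdvd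
    refine ih _ ?_ P (Q - algebraMap k A e * P ^ s) (adjoin_pair_sub_eq_top hPQ ?_) rfl
    · rw [map_sub, map_mul, map_pow, AlgHom.commutes]
      rw [← C_eq_algebraMap]
      omega
    · exact mul_mem (Subalgebra.algebraMap_mem _ _)
        (pow_mem (Algebra.subset_adjoin (Set.mem_singleton P)) s)
  exfalso
  obtain ⟨δ, hδ⟩ : ∃ δ, δ = (ε P).natDegree.gcd (ε Q).natDegree := ⟨_, rfl⟩
  have hδpos : 0 < δ := hδ ▸ Nat.gcd_pos_of_pos_left _ hpos
  obtain ⟨a, ha⟩ : δ ∣ (ε P).natDegree := hδ ▸ Nat.gcd_dvd_left _ _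
  obtain ⟨b, hb⟩ : δ ∣ (ε Q).natDegree := hδ ▸ Nat.gcd_dvd_right _ _
  have hab : a.Coprime b := by
    rw [ha, hb, Nat.gcd_mul_left] at hδ
    exact Nat.eq_of_mul_eq_mul_left hδpos (by rw [← hδ, mul_one])
  have ha2 : 2 ≤ a := by
    by_contra! hlt
    interval_cases a
    · simp [ha] at hpos
    · rw [ha, hb, mul_one] at hdvd
      exact hdvd ⟨b, rfl⟩
  have hb2 : 2 ≤ b := by
    by_contra! hlt
    have : δ * a ≤ δ * b := by rwa [← ha, ← hb]
    have := Nat.le_of_mul_le_mul_left this hδpos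
    omega
  obtain ⟨f, hf⟩ := exists_mvPolynomial_aeval_of_adjoin_pair_eq_top hPQ F
  let ι : L →ₐ[k] AlgebraicClosure L := IsScalarTower.toAlgHom k L _
  let ψ : A →ₐ[k] L := IsScalarTower.toAlgHom k A L
  have hL := intermediateField_adjoin_pair_eq_top (L := L) hPQ
  have hind : AlgebraicIndependent k ![ι (ψ P), ι (ψ Q)] := by
    convert (hcd.pair_of_adjoin_eq_top hL).map' (f := ι) ι.injective using 1
    ext i; fin_cases i <;> rfl
  refine false_of_field_generator (τ := ι g) hind (P := f) ?_ ha2 hb2 hab hδpos ha hb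
    (by rw [mvPolynomial_aeval_pair_map, hf, hε])
  have e : MvPolynomial.aeval ![ι (ψ P), ι (ψ Q)] f = ι (ψ F) := by
    rw [mvPolynomial_aeval_pair_map, mvPolynomial_aeval_pair_map, hf]
  rw [e]
  have := congrArg (IntermediateField.map ι) (hg.trans hL.symm)
  rwa [adjoin_map, adjoin_map, Set.image_pair, Set.image_pair] at this

end Coordinates

section GoodGenerator

open Polynomial IntermediateField

variable {k A L : Type*} [Field k] [CommRing A] [Algebra k A] [Field L] [Algebra k L]

theorem exists_eq_aeval_add_mul {P Q a : A} (ha : a ∈ Algebra.adjoin k {P, Q}) :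
    ∃ (r : k[X]), ∃ h ∈ Algebra.adjoin k {P, Q}, a = aeval Q r + P * h := by
  have hPm : P ∈ Algebra.adjoin k {P, Q} := Algebra.subset_adjoin (by simp)
  have hQm (r : k[X]) : aeval Q r ∈ Algebra.adjoin k {P, Q} :=
    Algebra.adjoin_mono (by simp) (aeval_mem_adjoin_singleton k Q)
  induction ha using Algebra.adjoin_induction with
  | mem x hx =>
    rcases hx with rfl | rfl
    · exact ⟨0, 1, one_mem _, by simp⟩
    · exact ⟨X, 0, zero_mem _, by simp⟩
  | algebraMap c => exact ⟨C c, 0, zero_mem _, by simp⟩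
  | add x y _ _ hx hy =>
    obtain ⟨r, h, hm, rfl⟩ := hx
    obtain ⟨s, h', hm', rfl⟩ := hy
    exact ⟨r + s, h + h', add_mem hm hm', by rw [map_add]; ring⟩
  | mul x y _ _ hx hy =>
    obtain ⟨r, h, hm, rfl⟩ := hx
    obtain ⟨s, h', hm', rfl⟩ := hy
    refine ⟨r * s, aeval Q r * h' + h * aeval Q s + P * h * h', ?_, by rw [map_mul]; ring⟩
    exact add_mem (add_mem (mul_mem (hQm r) hm') (mul_mem hm (hQm s)))
      (mul_mem (mul_mem hPm hm) hm')

theorem exists_generators_eq_add_mul [Algebra A L] [IsFractionRing A L] [IsScalarTower k A L]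
    {ε : A →ₐ[k] k[X]} {F : A} (hε : ε F = X) {g : L}
    (hg : adjoin k {algebraMap A L F, g} = ⊤) {c d : L} (hcd : AlgebraicIndependent k ![c, d])
    {P₀ Q₀ : A} (hPQ₀ : Algebra.adjoin k {P₀, Q₀} = ⊤) :
    ∃ P Q h : A, Algebra.adjoin k {P, Q} = ⊤ ∧ F = Q + P * h := by
  obtain ⟨P, Q, hPQ, hP⟩ := exists_generators_map_eq_zero hε hg hcd _ P₀ Q₀ hPQ₀ rfl
  obtain ⟨r, h, -, hF⟩ := exists_eq_aeval_add_mul (a := F) (P := P) (Q := Q) (k := k)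
    (by rw [hPQ]; trivial)
  have hr : r.comp (ε Q) = X := by
    have := congrArg ε hF
    rw [hε, map_add, map_mul, hP, zero_mul, add_zero, ← aeval_algHom_apply] at this
    rw [this, aeval_def, comp, algebraMap_eq]
  have hdeg : r.natDegree = 1 := by
    have := congrArg natDegree hr
    rw [natDegree_comp, natDegree_X] at this
    exact Nat.eq_one_of_mul_eq_one_right this
  obtain ⟨a, ha, b, rfl⟩ := natDegree_eq_one.1 hdeg
  refine ⟨P, _, h, adjoin_pair_eq_top_of_mem hPQ (Algebra.subset_adjoin (by simp)) ?_, hF⟩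
  have hm : aeval Q (C a * X + C b) ∈ Algebra.adjoin k {P, aeval Q (C a * X + C b)} :=
    Algebra.subset_adjoin (by simp)
  have : Q = algebraMap k A a⁻¹ * (aeval Q (C a * X + C b) - algebraMap k A b) := by
    rw [map_add, map_mul, aeval_C, aeval_C, aeval_X, add_sub_cancel_right, ← mul_assoc, ← map_mul,
      inv_mul_cancel₀ ha, map_one, one_mul]
  have hmem := mul_mem (Subalgebra.algebraMap_mem _ a⁻¹)
    (sub_mem hm (Subalgebra.algebraMap_mem _ b))
  rwa [← this] at hmem

theorem adjoin_inv_sub_eq_top {F g u : L} (hu : u ∈ k⟮F⟯) (h : adjoin k {F, g} = ⊤) :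
    adjoin k {F, (g - u)⁻¹} = ⊤ := by
  rw [eq_top_iff, ← h, adjoin_le_iff]
  have hF : F ∈ adjoin k {F, (g - u)⁻¹} := subset_adjoin _ _ (by simp)
  have hu' : u ∈ adjoin k {F, (g - u)⁻¹} := adjoin_simple_le_iff.2 hF hu
  rintro y (rfl | rfl)
  · exact hF
  · have h1 : (y - u)⁻¹ ∈ adjoin k {F, (y - u)⁻¹} := subset_adjoin _ _ (by simp)
    have := add_mem (inv_mem h1) hu'
    rwa [inv_inv, sub_add_cancel] at this

/-- After blowing up a point on the line `x = 0`, a field generator which is a coordinate on this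
line gets a polynomial companion. -/
theorem exists_generator_mem_adjoin_div {x y h g : L} (hxy : AlgebraicIndependent k ![x, y])
    (htop : adjoin k {x, y} = ⊤) (hh : h ∈ Algebra.adjoin k {x, y})
    (hg : adjoin k {y + x * h, g} = ⊤)
    (hR : ∀ a : L, IsIntegral (Algebra.adjoin k {x, y / x}) a → a ∈ Algebra.adjoin k {x, y / x}) :
    ∃ G ∈ Algebra.adjoin k {x, y / x}, adjoin k {y + x * h, G} = ⊤ := by
  obtain ⟨V, j, hj, hs⟩ := exists_isSpecialization hxy.pair_swap
  set v := V.valuation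
  set F := y + x * h with hF
  have hx0 := hs.ne_zero
  have hvy (r : k[X]) (hr : r ≠ 0) : v (aeval y r) = 1 := hj ▸ hs.val_aeval hr
  have hvy1 : v y = 1 := by simpa using hvy X X_ne_zero
  have hvh : v h ≤ 1 := by
    by_contra! hlt
    rcases exists_one_lt_of_mem_adjoin_pair hs.val_algebraMap hh hlt with h' | h'
    · exact h'.not_gt hs.val_lt_one
    · exact h'.ne' hvy1
  have hFy : v (F - y) < 1 := by
    rw [hF, add_sub_cancel_left, map_mul]
    exact mul_lt_one_of_lt_of_le hs.val_lt_one hvh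
  have hvF1 : v F ≤ 1 := by
    rw [v.map_eq_of_sub_lt (hvy1.symm ▸ hFy), hvy1]
  have hlead (r : k[X]) (hr : r ≠ 0) : SameLead v (aeval F r) (aeval y r) := by
    rw [SameLead, hvy r hr]
    exact Valuation.aeval_sub_aeval_lt_one hs.val_algebraMap hvF1 hvy1.le hFy r
  have hvF (r : k[X]) (hr : r ≠ 0) : v (aeval F r) = 1 := by
    rw [(hlead r hr).val_eq, hvy r hr]
  have hτ : ∃ τ, 1 < v τ ∧ adjoin k {F, τ} = ⊤ := by
    rcases lt_or_ge 1 (v g) with hlt | hle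
    · exact ⟨g, hlt, hg⟩
    have hind := algebraicIndependent_pair_iff.1 (hxy.pair_of_adjoin_eq_top hg)
    have hu : ∃ u ∈ k⟮F⟯, v (g - u) < 1 := by
      rcases hle.lt_or_eq with hlt | heq
      · exact ⟨0, zero_mem _, by simpa using hlt⟩
      have hg0 : g ≠ 0 := by rintro rfl; simp at heq
      obtain ⟨n, φ, hφ, hsl⟩ := hs.exists_sameLead (f := g)
        (by rw [hj, Set.pair_comm, htop]; trivial) hg0
      have hn : n = 0 := by
        refine hs.val_zpow_eq ?_
        have := hsl.val_eq
        rwa [heq, map_mul, hs.val_eq_one _ hφ, mul_one, map_zpow₀, eq_comm] at this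
      rw [hn, zpow_zero, one_mul, ← RatFunc.num_div_denom φ, map_div₀, ratFunc_algHom_algebraMap,
        ratFunc_algHom_algebraMap, hj] at hsl
      refine ⟨aeval F φ.num / aeval F φ.denom, (mem_adjoin_simple_iff _ _).2 ⟨_, _, rfl⟩, ?_⟩
      have hN := hlead φ.num (RatFunc.num_ne_zero hφ)
      have hD := hlead φ.denom φ.denom_ne_zero
      have hgF : SameLead v g (aeval F φ.num / aeval F φ.denom) := hsl.trans (hN.div hD).symm
      exact (show _ < _ from hgF).trans_eq (hgF.val_eq.symm.trans heq)
    obtain ⟨u, hu, hvu⟩ := hu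
    refine ⟨(g - u)⁻¹, ?_, adjoin_inv_sub_eq_top hu hg⟩
    have hgu : g - u ≠ 0 := by
      intro h0
      rw [sub_eq_zero.1 h0] at hind
      exact hind.2 (isAlgebraic_algebraMap (⟨u, hu⟩ : k⟮F⟯))
    rw [map_inv₀]
    exact (one_lt_inv₀ (by simpa [zero_lt_iff] using hgu)).2 hvu
  obtain ⟨τ, hτ, hFτ⟩ := hτ
  have hxB : x ∈ Algebra.adjoin k {x, y / x} := Algebra.subset_adjoin (by simp)
  have hyxB : y / x ∈ Algebra.adjoin k {x, y / x} := Algebra.subset_adjoin (by simp)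
  have hyB : y ∈ Algebra.adjoin k {x, y / x} := by
    have := mul_mem hxB hyxB
    rwa [mul_div_cancel₀ _ hx0] at this
  have hle : Algebra.adjoin k {x, y} ≤ Algebra.adjoin k {x, y / x} := by
    rw [Algebra.adjoin_le_iff]
    rintro a (rfl | rfl)
    exacts [hxB, hyB]
  obtain ⟨p, hp, hpτ⟩ := exists_aeval_mul_mem hR (add_mem hyB (mul_mem hxB (hle hh))) hvF hτ hyxB
    (by rw [map_div₀, hvy1]
        exact (one_lt_div₀ (by simpa [zero_lt_iff] using hx0)).2 hs.val_lt_one) hFτ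
  refine ⟨_, hpτ, adjoin_aeval_mul_eq_top ?_ hFτ⟩
  intro h0
  simpa [h0] using hvF p hp

end GoodGenerator

open MvPolynomial

section Equivalence

variable {k A L : Type*} [Field k] [CommRing A] [Field L] [Algebra k L]

theorem mem_of_isIntegral_of_algEquiv [Algebra A L] [IsFractionRing A L] {B : Subalgebra k L}
    (hB : Set.range (algebraMap A L) ⊆ (B : Set L)) (e : B ≃ₐ[k] MvPolynomial (Fin 2) k) {x : L}
    (hx : IsIntegral B x) : x ∈ B := by
  have : IsFractionRing B L := by
    refine IsFractionRing.of_field B L fun z => ?_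
    obtain ⟨a, b, -, rfl⟩ := IsFractionRing.div_surjective (A := A) z
    exact ⟨⟨_, hB ⟨a, rfl⟩⟩, ⟨_, hB ⟨b, rfl⟩⟩, rfl⟩
  have : IsIntegrallyClosed B := IsIntegrallyClosed.of_equiv e.symm.toRingEquiv
  obtain ⟨y, rfl⟩ := IsIntegrallyClosed.isIntegral_iff.1 hx
  exact y.2

theorem adjoin_X_pair :
    Algebra.adjoin k {X 0, X 1} = (⊤ : Subalgebra k (MvPolynomial (Fin 2) k)) := by
  have h2 : Set.range (X : Fin 2 → MvPolynomial (Fin 2) k) = {X 0, X 1} := by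
    ext; simp [Fin.exists_fin_two, eq_comm]
  rw [← h2, MvPolynomial.adjoin_range_X]

theorem exists_eq_adjoin_pair_of_algEquiv {B : Subalgebra k L}
    (e : B ≃ₐ[k] MvPolynomial (Fin 2) k) : ∃ U T : L, B = Algebra.adjoin k {U, T} := by
  let θ : MvPolynomial (Fin 2) k →ₐ[k] L := B.val.comp e.symm.toAlgHom
  refine ⟨θ (X 0), θ (X 1), ?_⟩
  have h1 : θ.range = B := by
    ext x
    constructor
    · rintro ⟨f, rfl⟩
      exact (e.symm f).2
    · intro hx
      exact ⟨e ⟨x, hx⟩, congrArg Subtype.val (e.symm_apply_apply ⟨x, hx⟩)⟩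
  rw [← h1, ← Algebra.map_top, ← adjoin_X_pair, AlgHom.map_adjoin, Set.image_pair]

theorem exists_algHom_of_bijective [Algebra k A] {F : A} {p : Ideal A}
    (hp : Function.Bijective fun q : Polynomial k => Ideal.Quotient.mk p (Polynomial.aeval F q)) :
    ∃ ε : A →ₐ[k] Polynomial k, ε F = Polynomial.X := by
  let e := AlgEquiv.ofBijective ((Ideal.Quotient.mkₐ k p).comp (Polynomial.aeval F)) hp
  refine ⟨e.symm.toAlgHom.comp (Ideal.Quotient.mkₐ k p), ?_⟩
  change e.symm _ = _
  rw [AlgEquiv.symm_apply_eq]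
  change _ = Ideal.Quotient.mk p (Polynomial.aeval F Polynomial.X)
  rw [Polynomial.aeval_X]
  rfl

theorem AlgebraicIndependent.pair_div {x y : L} (h : AlgebraicIndependent k ![x, y]) :
    AlgebraicIndependent k ![x, y / x] := by
  refine h.pair_of_adjoin_le ?_
  rw [IntermediateField.adjoin_le_iff]
  have hx : x ∈ IntermediateField.adjoin k {x, y / x} :=
    IntermediateField.subset_adjoin _ _ (by simp)
  have hyx : y / x ∈ IntermediateField.adjoin k {x, y / x} :=
    IntermediateField.subset_adjoin _ _ (by simp)
  have hx0 : x ≠ 0 := by simpa using h.ne_zero 0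
  rintro a (rfl | rfl)
  · exact hx
  · have := mul_mem hx hyx
    rwa [mul_div_cancel₀ _ hx0] at this

theorem AlgebraicIndependent.nonempty_adjoin_pair_algEquiv {x y : L}
    (h : AlgebraicIndependent k ![x, y]) :
    Nonempty (Algebra.adjoin k {x, y} ≃ₐ[k] MvPolynomial (Fin 2) k) := by
  rw [← Matrix.range_cons_cons_empty x y ![]]
  exact ⟨h.aevalEquiv.symm⟩

end Equivalence

/-- Let `F` be a bad field generator of `A = k[X,Y]`. Then `F` is a very
bad field generator of `A` (i.e. a bad field generator of every polynomial ring `B` in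
two variables over `k` with `A ⊆ B ⊆ Frac A` and `Frac B = Frac A`) if and only if
`Γ_alg(F,A) = ∅`. -/
theorem stmt18 (k : Type) [Field k] (L : Type) [Field L]
    [Algebra (MvPolynomial (Fin 2) k) L] [IsFractionRing (MvPolynomial (Fin 2) k) L]
    [Algebra k L] [IsScalarTower k (MvPolynomial (Fin 2) k) L]
    (F : MvPolynomial (Fin 2) k)
    (hFG : ∃ g : L, IntermediateField.adjoin k
        {algebraMap (MvPolynomial (Fin 2) k) L F, g} = ⊤)
    (hbad : ¬ ∃ G : MvPolynomial (Fin 2) k, IntermediateField.adjoin k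
        {algebraMap (MvPolynomial (Fin 2) k) L F,
         algebraMap (MvPolynomial (Fin 2) k) L G} = ⊤) :
    (∀ B : Subalgebra k L,
        Set.range (algebraMap (MvPolynomial (Fin 2) k) L) ⊆ (B : Set L) →
        Nonempty (B ≃ₐ[k] MvPolynomial (Fin 2) k) →
        ((∃ g : L, IntermediateField.adjoin k
            {algebraMap (MvPolynomial (Fin 2) k) L F, g} = ⊤)
          ∧ ¬ ∃ g ∈ B, IntermediateField.adjoin k
            {algebraMap (MvPolynomial (Fin 2) k) L F, g} = ⊤))
    ↔ GammaAlg k F = ∅ := by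
  let ψ : MvPolynomial (Fin 2) k →ₐ[k] L := IsScalarTower.toAlgHom k _ L
  have hψ : Function.Injective ψ := IsFractionRing.injective (MvPolynomial (Fin 2) k) L
  have hX : AlgebraicIndependent k ![ψ (X 0), ψ (X 1)] := by
    convert (algebraicIndependent_X (Fin 2) k).map' (f := ψ) hψ using 1
    ext i; fin_cases i <;> rfl
  constructor
  · intro h
    by_contra hne
    obtain ⟨p, -, hp⟩ := Set.nonempty_iff_ne_empty.2 hne
    obtain ⟨ε, hε⟩ := exists_algHom_of_bijective hp
    obtain ⟨g, hg⟩ := hFG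
    obtain ⟨P, Q, H, hPQ, rfl⟩ := exists_generators_eq_add_mul hε hg hX adjoin_X_pair
    have htop := intermediateField_adjoin_pair_eq_top (L := L) hPQ
    have hind := hX.pair_of_adjoin_eq_top htop
    obtain ⟨e⟩ := hind.pair_div.nonempty_adjoin_pair_algEquiv
    have hmem (a : MvPolynomial (Fin 2) k) :
        ψ a ∈ Algebra.adjoin k {ψ P, ψ Q} := by
      have ha : a ∈ Algebra.adjoin k {P, Q} := by rw [hPQ]; trivial
      have := (Subalgebra.mem_map (f := ψ)).2 ⟨a, ha, rfl⟩
      rwa [AlgHom.map_adjoin, Set.image_pair] at this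
    have hsub : Set.range (algebraMap (MvPolynomial (Fin 2) k) L) ⊆
        (Algebra.adjoin k {ψ P, ψ Q / ψ P} : Set L) := by
      have hP : ψ P ∈ Algebra.adjoin k {ψ P, ψ Q / ψ P} := Algebra.subset_adjoin (by simp)
      have hQP : ψ Q / ψ P ∈ Algebra.adjoin k {ψ P, ψ Q / ψ P} := Algebra.subset_adjoin (by simp)
      have hP0 : ψ P ≠ 0 := hind.ne_zero 0
      have hQ : ψ Q ∈ Algebra.adjoin k {ψ P, ψ Q / ψ P} := by
        have := mul_mem hP hQP
        rwa [mul_div_cancel₀ _ hP0] at this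
      rintro _ ⟨a, rfl⟩
      have hle : Algebra.adjoin k {ψ P, ψ Q} ≤ Algebra.adjoin k {ψ P, ψ Q / ψ P} := by
        rw [Algebra.adjoin_le_iff]
        rintro b (rfl | rfl)
        exacts [hP, hQ]
      exact hle (hmem a)
    refine (h _ hsub ⟨e⟩).2 ?_
    rw [map_add, map_mul] at hg ⊢
    exact exists_generator_mem_adjoin_div hind htop (hmem H) hg fun a ha =>
      mem_of_isIntegral_of_algEquiv hsub e ha
  · rintro hΓ B hB ⟨e⟩
    refine ⟨hFG, ?_⟩
    rintro ⟨G, hG, htop⟩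
    obtain ⟨U, T, rfl⟩ := exists_eq_adjoin_pair_of_algEquiv e
    have hrange : Set.range (algebraMap (MvPolynomial (Fin 2) k) L) ⊆ (ψ.range : Set L) :=
      fun _ h => h
    obtain ⟨V, w, hInt, hF, hres⟩ := exists_valuation_of_generator
      (IsScalarTower.toAlgHom k L (AlgebraicClosure L)) (R := ψ.range)
      (fun x hx => mem_of_isIntegral_of_algEquiv hrange (AlgEquiv.ofInjective ψ hψ).symm hx) hX
      ⟨F, rfl⟩ hB hG htop (by rintro _ ⟨g, rfl⟩ hg; exact hbad ⟨g, hg⟩)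
    obtain ⟨p, hp⟩ := exists_isPrime_bijective_of_valuation w
      (fun a => hInt _ ⟨a, rfl⟩) hF (fun a => hres _ ⟨a, rfl⟩)
    exact Set.eq_empty_iff_forall_notMem.1 hΓ p hp
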